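/- Let G be a unicyclic graph with b(G) ≥ 2. Then dim(G) − edim(G) = 1 if G contains configuration C but none of A, D, E; dim(G) − edim(G) = −1 if G contains configuration D or E but none of A, B, C; and dim(G) − edim(G) = 0 otherwise. (Containment of configurations is with respect to a smallest branch-resolving set, and is independent of the choice of such a set.) -/

import Mathlib

open SimpleGraph

section Defs

variable {V : Type*}

/-- Distance from a vertex `s` to an edge `e`: the minimum of the distances to its endpoints. -/
noncomputable def edgeDist (G : SimpleGraph V) (s : V) (e : Sym2 V) : ℕ :=
  Sym2.lift ⟨fun u w => min (G.dist s u) (G.dist s w), fun u w => min_comm _ _⟩ e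

/-- `S` is a vertex metric generator of `G`. -/
def IsVertexMG (G : SimpleGraph V) (S : Set V) : Prop :=
  ∀ u v : V, u ≠ v → ∃ s ∈ S, G.dist s u ≠ G.dist s v

/-- `S` is an edge metric generator of `G`. -/
def IsEdgeMG (G : SimpleGraph V) (S : Set V) : Prop :=
  ∀ e ∈ G.edgeSet, ∀ f ∈ G.edgeSet, e ≠ f → ∃ s ∈ S, edgeDist G s e ≠ edgeDist G s f

/-- The vertex metric dimension of `G`. -/
noncomputable def metricDim (G : SimpleGraph V) : ℕ :=
  sInf {n | ∃ S : Finset V, S.card = n ∧ IsVertexMG G ↑S}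

/-- The edge metric dimension of `G`. -/
noncomputable def edgeMetricDim (G : SimpleGraph V) : ℕ :=
  sInf {n | ∃ S : Finset V, S.card = n ∧ IsEdgeMG G ↑S}

/-- `G` is unicyclic: connected, contains a cycle, and any two cycles have the same edges. -/
def IsUnicyclic (G : SimpleGraph V) : Prop :=
  G.Connected ∧ (∃ (u : V) (w : G.Walk u u), w.IsCycle) ∧
    ∀ (u u' : V) (w : G.Walk u u) (w' : G.Walk u' u'), w.IsCycle → w'.IsCycle →
      ∀ e, e ∈ w.edges ↔ e ∈ w'.edges

/-- `vc : ZMod g → V` is a labelling `v_0 v_1 ⋯ v_{g-1}` of a cycle of length `g` in `G`. -/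
def IsCycleLabelling (G : SimpleGraph V) (g : ℕ) (vc : ZMod g → V) : Prop :=
  Function.Injective vc ∧ ∀ i : ZMod g, G.Adj (vc i) (vc (i + 1))

/-- The set of edges of the cycle `C`. -/
def cycleEdges (g : ℕ) (vc : ZMod g → V) : Set (Sym2 V) :=
  {e | ∃ i : ZMod g, e = s(vc i, vc (i + 1))}

/-- The graph `G - E(C)`. -/
def offCycle (G : SimpleGraph V) (g : ℕ) (vc : ZMod g → V) : SimpleGraph V :=
  G.deleteEdges (cycleEdges g vc)

/-- `x` belongs to `T_{v_i}`, the connected component of `G - E(C)` containing `v_i`. -/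
def inTree (G : SimpleGraph V) (g : ℕ) (vc : ZMod g → V) (i : ZMod g) (x : V) : Prop :=
  (offCycle G g vc).Reachable (vc i) x

/-- The vertex `v_i` of the cycle is `S`-active: `T_{v_i}` contains a vertex of `S`. -/
def SActive (G : SimpleGraph V) (g : ℕ) (vc : ZMod g → V) (S : Set V) (i : ZMod g) : Prop :=
  ∃ s ∈ S, inTree G g vc i s

/-- `a_S(C)`: the number of `S`-active vertices on the cycle. -/
noncomputable def aS (G : SimpleGraph V) (g : ℕ) (vc : ZMod g → V) (S : Set V) : ℕ :=
  {i : ZMod g | SActive G g vc S i}.ncard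

/-- `S` is biactive: `a_S(C) ≥ 2`. -/
def Biactive (G : SimpleGraph V) (g : ℕ) (vc : ZMod g → V) (S : Set V) : Prop :=
  2 ≤ aS G g vc S

variable [Fintype V] [DecidableEq V]

/-- `t = u_1 u_2 ⋯ u_k` is a thread hanging at the vertex `v`. -/
def IsThreadAt (G : SimpleGraph V) [DecidableRel G.Adj] (v : V) (t : List V) : Prop :=
  t ≠ [] ∧ t.Nodup ∧ v ∉ t ∧ 3 ≤ G.degree v ∧ List.Chain' G.Adj t ∧
    (∀ u ∈ t.head?, G.Adj v u) ∧ (∀ u ∈ t.getLast?, G.degree u = 1) ∧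
    ∀ u ∈ t.dropLast, G.degree u = 2

/-- The thread `t` is `S`-free: it contains no vertex of `S`. -/
def SFree (S : Set V) (t : List V) : Prop := ∀ u ∈ t, u ∉ S

/-- `S` is branch-resolving: for every vertex, all threads hanging at it except possibly
one contain a vertex of `S` (i.e. at most one thread at each vertex is `S`-free). -/
def BranchResolving (G : SimpleGraph V) [DecidableRel G.Adj] (S : Set V) : Prop :=
  ∀ v : V, ∀ t₁ t₂ : List V, IsThreadAt G v t₁ → IsThreadAt G v t₂ → t₁ ≠ t₂ →
    (∃ s ∈ S, s ∈ t₁) ∨ (∃ s ∈ S, s ∈ t₂)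

/-- `ℓ(v)`: the number of threads hanging at `v`. -/
noncomputable def numThreads (G : SimpleGraph V) [DecidableRel G.Adj] (v : V) : ℕ :=
  {t : List V | IsThreadAt G v t}.ncard

/-- `L(G) = Σ (ℓ(v) - 1)` (truncated subtraction makes the sum run exactly over the
vertices with `ℓ(v) > 1`). -/
noncomputable def LG (G : SimpleGraph V) [DecidableRel G.Adj] : ℕ :=
  ∑ v : V, (numThreads G v - 1)

/-- `x` is a branching vertex of the unicyclic graph with cycle `vc`. -/
def Branching (G : SimpleGraph V) [DecidableRel G.Adj] (g : ℕ) (vc : ZMod g → V) (x : V) :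
    Prop :=
  (x ∉ Set.range vc ∧ 3 ≤ G.degree x) ∨ (x ∈ Set.range vc ∧ 4 ≤ G.degree x)

/-- The cycle vertex `v_i` is branch-active: `T_{v_i}` contains a branching vertex. -/
def BranchActive (G : SimpleGraph V) [DecidableRel G.Adj] (g : ℕ) (vc : ZMod g → V)
    (i : ZMod g) : Prop :=
  ∃ x, inTree G g vc i x ∧ Branching G g vc x

/-- `b(G)`: the number of branch-active vertices on the cycle. -/
noncomputable def bG (G : SimpleGraph V) [DecidableRel G.Adj] (g : ℕ) (vc : ZMod g → V) : ℕ :=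
  {i : ZMod g | BranchActive G g vc i}.ncard

/-- `k = max { i : v_i is S-active }` for the labelling `vc` (indices taken in `[0, g-1]`). -/
noncomputable def kOf (G : SimpleGraph V) (g : ℕ) (vc : ZMod g → V) (S : Set V) : ℕ :=
  sSup {n : ℕ | n < g ∧ SActive G g vc S (n : ZMod g)}

/-- The labelling `vc` of the cycle is canonical with respect to `S`: `v_0` is `S`-active
and `k` is as small as possible among all labellings of the cycle with `v_0` `S`-active. -/
def Canonical (G : SimpleGraph V) (g : ℕ) (vc : ZMod g → V) (S : Set V) : Prop :=
  IsCycleLabelling G g vc ∧ SActive G g vc S 0 ∧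
    ∀ vc' : ZMod g → V, IsCycleLabelling G g vc' → Set.range vc' = Set.range vc →
      SActive G g vc' S 0 → kOf G g vc S ≤ kOf G g vc' S

/-- Configuration 𝒜 : `a_S(C) = 2`, `g` even and `k = g/2`. -/
def ConfigA (G : SimpleGraph V) (g : ℕ) (vc : ZMod g → V) (S : Set V) : Prop :=
  aS G g vc S = 2 ∧ Even g ∧ kOf G g vc S = g / 2

/-- Configuration ℬ : `k ≤ ⌊g/2⌋ - 1` and an `S`-free thread hangs at `v_i` for some
`i ∈ [k, ⌊g/2⌋-1] ∪ [⌈g/2⌉+k+1, g-1] ∪ {0}`. -/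
def ConfigB (G : SimpleGraph V) [DecidableRel G.Adj] (g : ℕ) (vc : ZMod g → V) (S : Set V) :
    Prop :=
  kOf G g vc S ≤ g / 2 - 1 ∧
    ∃ i : ℕ, ((kOf G g vc S ≤ i ∧ i ≤ g / 2 - 1) ∨
        ((g + 1) / 2 + kOf G g vc S + 1 ≤ i ∧ i ≤ g - 1) ∨ i = 0) ∧
      ∃ t : List V, IsThreadAt G (vc (i : ZMod g)) t ∧ SFree S t

/-- Configuration 𝒞 : `a_S(C) = 2`, `g` even, `k ≤ g/2` and an `S`-free thread of length
`≥ g/2 - k` hangs at `v_i` for some `i ∈ [0, k]`. -/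
def ConfigC (G : SimpleGraph V) [DecidableRel G.Adj] (g : ℕ) (vc : ZMod g → V) (S : Set V) :
    Prop :=
  aS G g vc S = 2 ∧ Even g ∧ kOf G g vc S ≤ g / 2 ∧
    ∃ i : ℕ, i ≤ kOf G g vc S ∧
      ∃ t : List V, IsThreadAt G (vc (i : ZMod g)) t ∧ SFree S t ∧
        g / 2 - kOf G g vc S ≤ t.length

/-- Configuration 𝒟 : `k ≤ ⌈g/2⌉ - 1` and an `S`-free thread hangs at `v_i` for some
`i ∈ [k, ⌈g/2⌉-1] ∪ [⌊g/2⌋+k+1, g-1] ∪ {0}`. -/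
def ConfigD (G : SimpleGraph V) [DecidableRel G.Adj] (g : ℕ) (vc : ZMod g → V) (S : Set V) :
    Prop :=
  kOf G g vc S ≤ (g + 1) / 2 - 1 ∧
    ∃ i : ℕ, ((kOf G g vc S ≤ i ∧ i ≤ (g + 1) / 2 - 1) ∨
        (g / 2 + kOf G g vc S + 1 ≤ i ∧ i ≤ g - 1) ∨ i = 0) ∧
      ∃ t : List V, IsThreadAt G (vc (i : ZMod g)) t ∧ SFree S t

/-- Configuration ℰ : `a_S(C) = 2` and an `S`-free thread of length `≥ ⌊g/2⌋ - k + 1`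
hangs at `v_i` with `i ∈ [0, k]`; moreover if `g` is even an `S`-free thread hangs at
`v_j` with `j = g/2 + k - i`. -/
def ConfigE (G : SimpleGraph V) [DecidableRel G.Adj] (g : ℕ) (vc : ZMod g → V) (S : Set V) :
    Prop :=
  aS G g vc S = 2 ∧
    ∃ i : ℕ, i ≤ kOf G g vc S ∧
      (∃ t : List V, IsThreadAt G (vc (i : ZMod g)) t ∧ SFree S t ∧
        g / 2 - kOf G g vc S + 1 ≤ t.length) ∧
      (Even g → ∃ t' : List V,
        IsThreadAt G (vc ((g / 2 + kOf G g vc S - i : ℕ) : ZMod g)) t' ∧ SFree S t')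

/-- `G` contains configuration 𝒜 with respect to `S` (evaluated on a canonical labelling
of the cycle given by `vc`). -/
def ContainsA (G : SimpleGraph V) (g : ℕ) (vc : ZMod g → V) (S : Set V) : Prop :=
  ∃ vc' : ZMod g → V, IsCycleLabelling G g vc' ∧ Set.range vc' = Set.range vc ∧
    Canonical G g vc' S ∧ ConfigA G g vc' S

/-- `G` contains configuration ℬ with respect to `S`. -/
def ContainsB (G : SimpleGraph V) [DecidableRel G.Adj] (g : ℕ) (vc : ZMod g → V)
    (S : Set V) : Prop :=
  ∃ vc' : ZMod g → V, IsCycleLabelling G g vc' ∧ Set.range vc' = Set.range vc ∧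
    Canonical G g vc' S ∧ ConfigB G g vc' S

/-- `G` contains configuration 𝒞 with respect to `S`. -/
def ContainsC (G : SimpleGraph V) [DecidableRel G.Adj] (g : ℕ) (vc : ZMod g → V)
    (S : Set V) : Prop :=
  ∃ vc' : ZMod g → V, IsCycleLabelling G g vc' ∧ Set.range vc' = Set.range vc ∧
    Canonical G g vc' S ∧ ConfigC G g vc' S

/-- `G` contains configuration 𝒟 with respect to `S`. -/
def ContainsD (G : SimpleGraph V) [DecidableRel G.Adj] (g : ℕ) (vc : ZMod g → V)
    (S : Set V) : Prop :=
  ∃ vc' : ZMod g → V, IsCycleLabelling G g vc' ∧ Set.range vc' = Set.range vc ∧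
    Canonical G g vc' S ∧ ConfigD G g vc' S

/-- `G` contains configuration ℰ with respect to `S`. -/
def ContainsE (G : SimpleGraph V) [DecidableRel G.Adj] (g : ℕ) (vc : ZMod g → V)
    (S : Set V) : Prop :=
  ∃ vc' : ZMod g → V, IsCycleLabelling G g vc' ∧ Set.range vc' = Set.range vc ∧
    Canonical G g vc' S ∧ ConfigE G g vc' S

/-- `G` contains one of the configurations 𝒜, ℬ, 𝒞 with respect to `S`. -/
def ContainsABC (G : SimpleGraph V) [DecidableRel G.Adj] (g : ℕ) (vc : ZMod g → V)
    (S : Set V) : Prop :=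
  ContainsA G g vc S ∨ ContainsB G g vc S ∨ ContainsC G g vc S

/-- `G` contains one of the configurations 𝒜, 𝒟, ℰ with respect to `S`. -/
def ContainsADE (G : SimpleGraph V) [DecidableRel G.Adj] (g : ℕ) (vc : ZMod g → V)
    (S : Set V) : Prop :=
  ContainsA G g vc S ∨ ContainsD G g vc S ∨ ContainsE G g vc S

/-- `S` is a smallest branch-resolving set of `G`. -/
def SmallestBR (G : SimpleGraph V) [DecidableRel G.Adj] (S : Finset V) : Prop :=
  BranchResolving G ↑S ∧ ∀ S' : Finset V, BranchResolving G ↑S' → S.card ≤ S'.card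

/-- `S` is a smallest biactive branch-resolving set of `G`. -/
def SmallestBBR (G : SimpleGraph V) [DecidableRel G.Adj] (g : ℕ) (vc : ZMod g → V)
    (S : Finset V) : Prop :=
  BranchResolving G ↑S ∧ Biactive G g vc ↑S ∧
    ∀ S' : Finset V, BranchResolving G ↑S' → Biactive G g vc ↑S' → S.card ≤ S'.card

/-- `G` is 𝒜ℬ𝒞-negative. -/
def ABCneg (G : SimpleGraph V) [DecidableRel G.Adj] (g : ℕ) (vc : ZMod g → V) : Prop :=
  ∃ S : Finset V, SmallestBBR G g vc S ∧ ¬ ContainsABC G g vc ↑S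

/-- `G` is 𝒜𝒟ℰ-negative. -/
def ADEneg (G : SimpleGraph V) [DecidableRel G.Adj] (g : ℕ) (vc : ZMod g → V) : Prop :=
  ∃ S : Finset V, SmallestBBR G g vc S ∧ ¬ ContainsADE G g vc ↑S

end Defs

namespace Unicyclic

/-- A description of `G` as a cycle `vc` with rooted trees attached to it: `par` sends an off-cycle
vertex to its neighbour closer to the cycle, `ht` is the distance to the cycle, and `rt` is the
index of the cycle vertex whose tree contains the given vertex. -/
structure Pres {V : Type*} (G : SimpleGraph V) (g : ℕ) (vc : ZMod g → V) where
  par : V → V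
  ht : V → ℕ
  rt : V → ZMod g
  eq_of_ht : ∀ x, ht x = 0 → x = vc (rt x)
  ht_vc : ∀ i, ht (vc i) = 0
  rt_vc : ∀ i, rt (vc i) = i
  ht_par : ∀ x, 0 < ht x → ht (par x) + 1 = ht x
  rt_par : ∀ x, 0 < ht x → rt (par x) = rt x
  adj_iff : ∀ x y, G.Adj x y ↔ (0 < ht x ∧ par x = y) ∨ (0 < ht y ∧ par y = x) ∨
    ∃ i, (x = vc i ∧ y = vc (i + 1)) ∨ (y = vc i ∧ x = vc (i + 1))

lemma exists_adj_dist {V : Type*} {G : SimpleGraph V} (hG : G.Connected) {s x : V}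
    (hne : x ≠ s) : ∃ z, G.Adj z x ∧ G.dist s z + 1 = G.dist s x := by
  obtain ⟨p, hp⟩ := hG.exists_walk_length_eq_dist x s
  cases p with
  | nil => exact absurd rfl hne
  | cons h q =>
    rename_i z
    refine ⟨z, h.symm, ?_⟩
    have h1 : G.dist s z ≤ q.length := by rw [dist_comm]; exact dist_le q
    have h2 : G.dist s x ≤ G.dist s z + G.dist z x := hG.dist_triangle
    have h3 : G.dist z x = 1 := dist_eq_one_iff_adj.2 h.symm
    rw [dist_comm (u := x)] at hp
    simp only [Walk.length_cons] at hp
    omega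

lemma dist_le_succ {V : Type*} {G : SimpleGraph V} (hG : G.Connected) (s : V) {x y : V}
    (h : G.Adj x y) : G.dist s y ≤ G.dist s x + 1 := by
  have h2 : G.dist s y ≤ G.dist s x + G.dist x y := hG.dist_triangle
  rwa [dist_eq_one_iff_adj.2 h] at h2

lemma dist_eq_of_descent {V : Type*} {G : SimpleGraph V} (hG : G.Connected) (s : V) (f : V → ℕ)
    (h0 : f s = 0) (hL : ∀ x y, G.Adj x y → f y ≤ f x + 1)
    (hd : ∀ y, y ≠ s → ∃ z, G.Adj z y ∧ f z + 1 = f y) (y : V) : G.dist s y = f y := by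
  apply le_antisymm
  · induction hn : f y using Nat.strong_induction_on generalizing y with
    | _ n ih =>
      by_cases hy : y = s
      · subst hy; simp
      · obtain ⟨z, hz, hfz⟩ := hd y hy
        have := ih (f z) (by omega) z rfl
        have := dist_le_succ hG s hz
        omega
  · induction hn : G.dist s y using Nat.strong_induction_on generalizing y with
    | _ n ih =>
      by_cases hy : y = s
      · subst hy; omega
      · obtain ⟨z, hz, hfz⟩ := exists_adj_dist hG hy
        have := ih (G.dist s z) (by omega) z rfl
        have := hL z y hz
        omega

section Existence

variable {V : Type*} {G : SimpleGraph V} {g : ℕ} {vc : ZMod g → V}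

lemma two_ne_zero_zmod (hg : 3 ≤ g) : (2 : ZMod g) ≠ 0 := by
  intro h
  have h2 : ((2 : ℕ) : ZMod g) = 0 := by exact_mod_cast h
  rw [ZMod.natCast_eq_zero_iff] at h2
  have := Nat.le_of_dvd (by norm_num) h2
  omega

lemma cycle_edge_inj (hg : 3 ≤ g) (hvc : IsCycleLabelling G g vc) {i j : ZMod g}
    (h : s(vc i, vc (i + 1)) = s(vc j, vc (j + 1))) : i = j := by
  rw [Sym2.eq_iff] at h
  rcases h with ⟨h, -⟩ | ⟨h1, h2⟩
  · exact hvc.1 h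
  · have h1 := hvc.1 h1
    have h2 := hvc.1 h2
    exfalso
    apply two_ne_zero_zmod hg
    have h3 : j + 1 + 1 = j := by rw [← h1]; exact h2
    have h4 : j + 2 = j + 0 := by rw [add_zero]; nth_rewrite 2 [← h3]; ring
    exact add_left_cancel h4

lemma cycle_edge_not_bridge (hg : 3 ≤ g) (hvc : IsCycleLabelling G g vc) :
    ¬ G.IsBridge s(vc 0, vc (0 + 1)) := by
  rw [isBridge_iff, not_not]
  have key : ∀ n : ℕ, n + 1 ≤ g →
      (G.deleteEdges {s(vc 0, vc (0 + 1))}).Reachable (vc (0 + 1)) (vc ((n + 1 : ℕ) : ZMod g)) := by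
    intro n
    induction n with
    | zero => intro _; simp
    | succ n ih =>
      intro hn
      refine (ih (by omega)).trans (Adj.reachable ?_)
      rw [deleteEdges_adj]
      refine ⟨by have := hvc.2 ((n + 1 : ℕ) : ZMod g); push_cast at this ⊢; exact this, ?_⟩
      intro h
      have h' : s(vc ((n + 1 : ℕ) : ZMod g), vc (((n + 1 : ℕ) : ZMod g) + 1)) =
          s(vc 0, vc (0 + 1)) := by
        rw [Set.mem_singleton_iff] at h
        rw [← h]; push_cast; rfl
      have := cycle_edge_inj hg hvc h'
      rw [ZMod.natCast_eq_zero_iff] at this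
      have := Nat.le_of_dvd (by omega) this
      omega
  have := key (g - 1) (by omega)
  rw [Nat.sub_add_cancel (by omega), ZMod.natCast_self] at this
  exact this.symm

variable [Fintype V] [DecidableEq V] [DecidableRel G.Adj]

lemma card_edges (hG : IsUnicyclic G) (hg : 3 ≤ g) (hvc : IsCycleLabelling G g vc) :
    G.edgeFinset.card = Fintype.card V := by
  have hnb := cycle_edge_not_bridge hg hvc
  have hadj : G.Adj (vc 0) (vc (0 + 1)) := hvc.2 0
  have hconn := hG.1.connected_delete_edge_of_not_isBridge hnb
  rw [isBridge_iff_forall_cycle_notMem (e := s(vc 0, vc (0 + 1))) hadj] at hnb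
  push Not at hnb
  obtain ⟨u, w, hw, hew⟩ := hnb
  have hacyc : (G.deleteEdges {s(vc 0, vc (0 + 1))}).IsAcyclic := by
    intro u' w' hw'
    have hle : G.deleteEdges {s(vc 0, vc (0 + 1))} ≤ G := deleteEdges_le _
    have h1 := (hG.2.2 _ _ w (w'.mapLe hle) hw ((Walk.isCycle_mapLe hle).2 hw') _).1 hew
    rw [Walk.edges_mapLe_eq_edges] at h1
    have h2 := w'.edges_subset_edgeSet h1
    rw [edgeSet_deleteEdges] at h2
    exact h2.2 rfl
  have ht : (G.deleteEdges {s(vc 0, vc (0 + 1))}).IsTree := ⟨hconn, hacyc⟩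
  classical
  have hc := ht.card_edgeFinset
  have he : (G.deleteEdges {s(vc 0, vc (0 + 1))}).edgeFinset =
      G.edgeFinset.erase s(vc 0, vc (0 + 1)) := by
    ext e
    simp only [mem_edgeFinset, edgeSet_deleteEdges, Finset.mem_erase, Set.mem_sdiff,
      Set.mem_singleton_iff]
    tauto
  rw [he, Finset.card_erase_of_mem (by simpa using hadj)] at hc
  have : 0 < G.edgeFinset.card := Finset.card_pos.2 ⟨s(vc 0, vc (0 + 1)), by simpa using hadj⟩
  omega

lemma exists_pres (hG : IsUnicyclic G) (hg : 3 ≤ g) (hvc : IsCycleLabelling G g vc) :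
    Nonempty (Pres G g vc) := by
  classical
  have : NeZero g := ⟨by omega⟩
  let ht : V → ℕ := fun x => sInf {n | ∃ i, G.dist (vc i) x = n}
  have hmem : ∀ x, ∃ i, G.dist (vc i) x = ht x := fun x =>
    Nat.sInf_mem (s := {n | ∃ i, G.dist (vc i) x = n}) ⟨_, 0, rfl⟩
  have hle : ∀ x i, ht x ≤ G.dist (vc i) x := fun x i => Nat.sInf_le ⟨i, rfl⟩
  have ht_vc : ∀ i, ht (vc i) = 0 := fun i => by
    have := hle (vc i) i
    simpa using this
  have hex : ∀ x, ∃ y, 0 < ht x → G.Adj y x ∧ ht y + 1 = ht x := by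
    intro x
    by_cases hx : 0 < ht x
    · obtain ⟨i, hi⟩ := hmem x
      have hne : x ≠ vc i := by
        rintro rfl
        rw [ht_vc] at hx
        omega
      obtain ⟨z, hz, hd⟩ := exists_adj_dist hG.1 hne
      refine ⟨z, fun _ => ⟨hz, ?_⟩⟩
      have h1 := hle z i
      obtain ⟨j, hj⟩ := hmem z
      have h2 := dist_le_succ hG.1 (vc j) hz
      have h3 := hle x j
      omega
    · exact ⟨x, fun h => absurd h hx⟩
  choose par hpar using hex
  have hroot : ∀ n x, ht x = n → ∃ i, vc i = par^[n] x := by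
    intro n
    induction n with
    | zero =>
      intro x hx
      obtain ⟨i, hi⟩ := hmem x
      rw [hx] at hi
      exact ⟨i, hG.1.dist_eq_zero_iff.1 hi⟩
    | succ n ih =>
      intro x hx
      rw [Function.iterate_succ_apply]
      have := (hpar x (by omega)).2
      exact ih _ (by omega)
  choose rt hrt using fun x => hroot (ht x) x rfl
  have ht_par : ∀ x, 0 < ht x → ht (par x) + 1 = ht x := fun x hx => (hpar x hx).2
  have hcard := card_edges hG hg hvc
  let F₁ := (Finset.univ.filter fun x => 0 < ht x).image fun x => s(x, par x)
  let F₂ := (Finset.univ : Finset (ZMod g)).image fun i => s(vc i, vc (i + 1))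
  have hdisj : Disjoint F₁ F₂ := by
    rw [Finset.disjoint_left]
    intro e h1 h2
    simp only [F₁, F₂, Finset.mem_image, Finset.mem_filter, Finset.mem_univ, true_and] at h1 h2
    obtain ⟨x, hx, rfl⟩ := h1
    obtain ⟨i, hi⟩ := h2
    rw [Sym2.eq_iff] at hi
    rcases hi with ⟨h, -⟩ | ⟨-, h⟩
    · rw [← h, ht_vc] at hx; omega
    · rw [← h, ht_vc] at hx; omega
  have hc1 : F₁.card = (Finset.univ.filter fun x => 0 < ht x).card := by
    apply Finset.card_image_of_injOn
    intro x hx y hy hxy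
    simp only [Finset.coe_filter, Finset.mem_univ, true_and, Set.mem_ofPred_eq] at hx hy
    simp only [Sym2.eq_iff] at hxy
    rcases hxy with ⟨h, -⟩ | ⟨h1, h2⟩
    · exact h
    · have h3 := ht_par x hx
      have h4 := ht_par y hy
      rw [h2] at h3
      rw [← h1] at h4
      omega
  have hc2 : F₂.card = g := by
    rw [Finset.card_image_of_injective _ fun i j h => cycle_edge_inj hg hvc h]
    simp [ZMod.card]
  have hc3 : (Finset.univ.filter fun x => ¬ 0 < ht x).card = g := by
    have : (Finset.univ.filter fun x => ¬ 0 < ht x) = (Finset.univ : Finset (ZMod g)).image vc := by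
      ext x
      simp only [Finset.mem_filter, Finset.mem_univ, true_and, Finset.mem_image]
      constructor
      · intro hx
        have h0 : ht x = 0 := by omega
        have := hrt x
        rw [h0] at this
        exact ⟨_, this⟩
      · rintro ⟨i, rfl⟩
        rw [ht_vc]; omega
    rw [this, Finset.card_image_of_injective _ hvc.1]
    simp [ZMod.card]
  have hsub : F₁ ∪ F₂ ⊆ G.edgeFinset := by
    intro e he
    simp only [F₁, F₂, Finset.mem_union, Finset.mem_image, Finset.mem_filter, Finset.mem_univ,
      true_and] at he
    rw [mem_edgeFinset]
    rcases he with ⟨x, hx, rfl⟩ | ⟨i, rfl⟩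
    · exact (hpar x hx).1.symm
    · exact hvc.2 i
  have heq : F₁ ∪ F₂ = G.edgeFinset := by
    apply Finset.eq_of_subset_of_card_le hsub
    rw [Finset.card_union_of_disjoint hdisj, hc1, hc2, hcard, ← Finset.card_univ]
    have := Finset.card_filter_add_card_filter_not (s := (Finset.univ : Finset V))
      (fun x => 0 < ht x)
    omega
  refine ⟨⟨par, ht, rt, ?_, ht_vc, ?_, ht_par, ?_, ?_⟩⟩
  · intro x hx
    have := hrt x
    rw [hx] at this
    exact this.symm
  · intro i
    have := hrt (vc i)
    rw [ht_vc] at this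
    exact hvc.1 this
  · intro x hx
    have h1 := hrt x
    have h2 := hrt (par x)
    rw [← ht_par x hx, Function.iterate_succ_apply, ← h2] at h1
    exact (hvc.1 h1).symm
  · intro x y
    constructor
    · intro h
      have : s(x, y) ∈ F₁ ∪ F₂ := by rw [heq]; simpa using h
      simp only [F₁, F₂, Finset.mem_union, Finset.mem_image, Finset.mem_filter, Finset.mem_univ,
        true_and, Sym2.eq_iff] at this
      rcases this with ⟨z, hz, ⟨rfl, rfl⟩ | ⟨rfl, rfl⟩⟩ | ⟨i, ⟨rfl, rfl⟩ | ⟨rfl, rfl⟩⟩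
      · exact Or.inl ⟨hz, rfl⟩
      · exact Or.inr (Or.inl ⟨hz, rfl⟩)
      · exact Or.inr (Or.inr ⟨i, Or.inl ⟨rfl, rfl⟩⟩)
      · exact Or.inr (Or.inr ⟨i, Or.inr ⟨rfl, rfl⟩⟩)
    · rintro (⟨hx, rfl⟩ | ⟨hy, rfl⟩ | ⟨i, ⟨rfl, rfl⟩ | ⟨rfl, rfl⟩⟩)
      · exact (hpar x hx).1.symm
      · exact (hpar y hy).1
      · exact hvc.2 i
      · exact (hvc.2 i).symm

end Existence

end Unicyclic

namespace Unicyclic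

section CycleDistance

variable {g : ℕ}

/-- The distance between `i` and `j` on a cycle of length `g`. -/
def cd (i j : ZMod g) : ℕ :=
  min (i.val - j.val + (j.val - i.val)) (g - (i.val - j.val + (j.val - i.val)))

/-- The distance on a cycle of length `g` from `i` to the edge joining `j` and `j + 1`. -/
def ced (i j : ZMod g) : ℕ := min (cd i j) (cd i (j + 1))

lemma cd_comm (i j : ZMod g) : cd i j = cd j i := by
  unfold cd
  rw [add_comm]

lemma val_succ (hg : 3 ≤ g) (j : ZMod g) :
    (j + 1).val = if j.val + 1 = g then 0 else j.val + 1 := by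
  have : NeZero g := ⟨by omega⟩
  have h1 : (1 : ZMod g).val = 1 := by
    have := ZMod.val_natCast_of_lt (n := g) (a := 1) (by omega)
    simpa using this
  have hj := ZMod.val_lt j
  rw [ZMod.val_add, h1]
  split_ifs with h
  · rw [h, Nat.mod_self]
  · exact Nat.mod_eq_of_lt (by omega)

lemma cd_self (i : ZMod g) : cd i i = 0 := by simp [cd]

lemma cd_triangle (hg : 3 ≤ g) (i j k : ZMod g) : cd i k ≤ cd i j + cd j k := by
  have : NeZero g := ⟨by omega⟩
  have hi := ZMod.val_lt i
  have hj := ZMod.val_lt j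
  have hk := ZMod.val_lt k
  unfold cd
  omega

lemma cd_succ_le (hg : 3 ≤ g) (i j : ZMod g) : cd i (j + 1) ≤ cd i j + 1 := by
  have : NeZero g := ⟨by omega⟩
  have hi := ZMod.val_lt i
  have hj := ZMod.val_lt j
  unfold cd
  rw [val_succ hg]
  split_ifs <;> omega

lemma cd_le_succ (hg : 3 ≤ g) (i j : ZMod g) : cd i j ≤ cd i (j + 1) + 1 := by
  have : NeZero g := ⟨by omega⟩
  have hi := ZMod.val_lt i
  have hj := ZMod.val_lt j
  unfold cd
  rw [val_succ hg]
  split_ifs <;> omega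

lemma cd_descent (hg : 3 ≤ g) {i j : ZMod g} (h : i ≠ j) :
    cd i (j + 1) + 1 = cd i j ∨ ∃ m, m + 1 = j ∧ cd i m + 1 = cd i j := by
  have : NeZero g := ⟨by omega⟩
  have hi := ZMod.val_lt i
  have hj := ZMod.val_lt j
  have hne : i.val ≠ j.val := fun h' => h (ZMod.val_injective g h')
  by_cases h1 : cd i (j + 1) + 1 = cd i j
  · exact Or.inl h1
  · refine Or.inr ⟨j - 1, sub_add_cancel j 1, ?_⟩
    have hm := val_succ hg (j - 1)
    have hm' := ZMod.val_lt (j - 1)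
    rw [sub_add_cancel] at hm
    have hs := val_succ hg j
    unfold cd at *
    rw [hs] at h1
    split_ifs at hm h1 <;> omega

end CycleDistance

namespace Pres

variable {V : Type*} {G : SimpleGraph V} {g : ℕ} {vc : ZMod g → V} (P : Pres G g vc)

/-- `P.Desc a x` says that `x` is a descendant of `a` (possibly `a` itself). -/
inductive Desc (a : V) : V → Prop
  | refl : Desc a a
  | step (y : V) : 0 < P.ht y → Desc a (P.par y) → Desc a y

variable {P}

lemma adj_par {x : V} (hx : 0 < P.ht x) : G.Adj x (P.par x) :=
  (P.adj_iff _ _).2 (Or.inl ⟨hx, rfl⟩)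

lemma adj_cases {x y : V} (h : G.Adj x y) : (0 < P.ht x ∧ P.par x = y) ∨
    (0 < P.ht y ∧ P.par y = x) ∨
      (P.ht x = 0 ∧ P.ht y = 0 ∧ (P.rt y = P.rt x + 1 ∨ P.rt x = P.rt y + 1)) := by
  rcases (P.adj_iff x y).1 h with h | h | ⟨i, ⟨rfl, rfl⟩ | ⟨rfl, rfl⟩⟩
  · exact Or.inl h
  · exact Or.inr (Or.inl h)
  · exact Or.inr (Or.inr ⟨P.ht_vc _, P.ht_vc _, Or.inl (by rw [P.rt_vc, P.rt_vc])⟩)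
  · exact Or.inr (Or.inr ⟨P.ht_vc _, P.ht_vc _, Or.inr (by rw [P.rt_vc, P.rt_vc])⟩)

lemma Desc.ht_le {a x : V} (h : P.Desc a x) : P.ht a ≤ P.ht x := by
  induction h with
  | refl => rfl
  | step y hy _ ih => have := P.ht_par y hy; omega

lemma Desc.rt_eq {a x : V} (h : P.Desc a x) : P.rt x = P.rt a := by
  induction h with
  | refl => rfl
  | step y hy _ ih => rw [← P.rt_par y hy, ih]

lemma Desc.trans {a b x : V} (h : P.Desc a b) (h' : P.Desc b x) : P.Desc a x := by
  induction h' with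
  | refl => exact h
  | step y hy _ ih => exact .step y hy ih

lemma Desc.cases_up {a x : V} (h : P.Desc a x) : a = x ∨ (0 < P.ht x ∧ P.Desc a (P.par x)) := by
  cases h with
  | refl => exact Or.inl rfl
  | step _ hx h => exact Or.inr ⟨hx, h⟩

lemma desc_par {x : V} (hx : 0 < P.ht x) : P.Desc (P.par x) x := .step x hx .refl

lemma Desc.cases_down {a x : V} (h : P.Desc a x) :
    a = x ∨ ∃ c, 0 < P.ht c ∧ P.par c = a ∧ P.Desc c x := by
  induction h with
  | refl => exact Or.inl rfl
  | step y hy _ ih =>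
    right
    rcases ih with h | ⟨c, hc, hca, hcy⟩
    · exact ⟨y, hy, h.symm, .refl⟩
    · exact ⟨c, hc, hca, .step y hy hcy⟩

lemma Desc.comparable {a b x : V} (ha : P.Desc a x) (hb : P.Desc b x) :
    P.Desc a b ∨ P.Desc b a := by
  induction ha with
  | refl => exact Or.inr hb
  | step y hy hay ih =>
    rcases hb.cases_up with rfl | ⟨-, h⟩
    · exact Or.inl (.step _ hy hay)
    · exact ih h

lemma Desc.eq_of_ht {a x : V} (h : P.Desc a x) (he : P.ht a = P.ht x) : a = x := by
  rcases h.cases_up with h | ⟨hx, h⟩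
  · exact h
  · have := h.ht_le
    have := P.ht_par x hx
    omega

lemma Desc.eq_of_desc {a b x : V} (ha : P.Desc a x) (hb : P.Desc b x) (h : P.ht a = P.ht b) :
    a = b := by
  rcases ha.comparable hb with h' | h'
  · exact h'.eq_of_ht h
  · exact (h'.eq_of_ht h.symm).symm

lemma exists_desc_ht {n : ℕ} {x : V} (h : n ≤ P.ht x) : ∃ a, P.Desc a x ∧ P.ht a = n := by
  induction hm : P.ht x generalizing x with
  | zero => exact ⟨x, .refl, by omega⟩
  | succ m ih =>
    by_cases hn : n = P.ht x
    · exact ⟨x, .refl, hn.symm⟩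
    · have := P.ht_par x (by omega)
      obtain ⟨a, ha, hna⟩ := ih (x := P.par x) (by omega) (by omega)
      exact ⟨a, .step x (by omega) ha, hna⟩

lemma dist_par (hG : G.Connected) {c s : V} (hc : 0 < P.ht c) (h : ¬ P.Desc c s) :
    G.dist s c = G.dist s (P.par c) + 1 := by
  induction hn : G.dist s c using Nat.strong_induction_on generalizing c with
  | _ n ih =>
    have hne : c ≠ s := by rintro rfl; exact h .refl
    obtain ⟨z, hz, hd⟩ := exists_adj_dist hG hne
    rcases adj_cases (P := P) hz with ⟨hz0, rfl⟩ | ⟨-, rfl⟩ | ⟨-, h0, -⟩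
    · have := ih (G.dist s z) (by omega) hz0 (fun hzs => h ((desc_par hz0).trans hzs)) rfl
      omega
    · omega
    · omega

lemma dist_desc (hG : G.Connected) {b x s : V} (hb : 0 < P.ht b) (hx : P.Desc b x)
    (hs : ¬ P.Desc b s) : G.dist s x + P.ht (P.par b) = G.dist s (P.par b) + P.ht x := by
  induction hx with
  | refl =>
    have := dist_par hG hb hs
    have := P.ht_par b hb
    omega
  | step y hy hby ih =>
    have := dist_par hG hy (fun h => hs ((Desc.step y hy hby).trans h))
    have := P.ht_par y hy
    omega

lemma dist_anc (hG : G.Connected) {a x : V} (h : P.Desc a x) :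
    G.dist a x + P.ht a = P.ht x := by
  induction h with
  | refl => simp
  | step y hy hay ih =>
    have h1 := P.ht_par y hy
    have := dist_par (s := a) hG hy (fun h => by have := hay.ht_le; have := h.ht_le; omega)
    omega

lemma dist_vc (hG : G.Connected) (hg : 3 ≤ g) (i : ZMod g) (x : V) :
    G.dist (vc i) x = cd i (P.rt x) + P.ht x := by
  refine dist_eq_of_descent hG (vc i) (fun x => cd i (P.rt x) + P.ht x) ?_ ?_ ?_ x
  · simp [P.ht_vc, P.rt_vc, cd_self]
  · intro x y hxy
    rcases adj_cases (P := P) hxy with ⟨hx, rfl⟩ | ⟨hy, rfl⟩ | ⟨hx, hy, h | h⟩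
    · have := P.ht_par x hx
      simp only [P.rt_par x hx]
      omega
    · have := P.ht_par y hy
      simp only [P.rt_par y hy]
      omega
    · have := cd_succ_le hg i (P.rt x)
      simp only [h]
      omega
    · have := cd_le_succ hg i (P.rt y)
      simp only [h]
      omega
  · intro y hy
    by_cases h0 : 0 < P.ht y
    · refine ⟨P.par y, (adj_par h0).symm, ?_⟩
      have := P.ht_par y h0
      simp only [P.rt_par y h0]
      omega
    · have h0 : P.ht y = 0 := by omega
      have hy' := P.eq_of_ht y h0
      have hne : i ≠ P.rt y := by
        intro h
        rw [← h] at hy'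
        exact hy hy'
      rcases cd_descent hg hne with h | ⟨m, hm, h⟩
      · refine ⟨vc (P.rt y + 1), ?_, ?_⟩
        · exact (P.adj_iff _ _).2 (Or.inr (Or.inr ⟨P.rt y, Or.inr ⟨hy', rfl⟩⟩))
        · simp only [P.rt_vc, P.ht_vc]; omega
      · refine ⟨vc m, ?_, ?_⟩
        · exact (P.adj_iff _ _).2 (Or.inr (Or.inr ⟨m, Or.inl ⟨rfl, hm ▸ hy'⟩⟩))
        · simp only [P.rt_vc, P.ht_vc]; omega

lemma dist_le (hG : G.Connected) (hg : 3 ≤ g) (s x : V) :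
    G.dist s x ≤ P.ht s + cd (P.rt s) (P.rt x) + P.ht x := by
  have h1 := dist_vc (P := P) hG hg (P.rt s) x
  have h2 := dist_vc (P := P) hG hg (P.rt s) s
  rw [cd_self, dist_comm] at h2
  have h3 : G.dist s x ≤ G.dist s (vc (P.rt s)) + G.dist (vc (P.rt s)) x := hG.dist_triangle
  omega

lemma par_eq_vc {b : V} (hb : P.ht b = 1) : P.par b = vc (P.rt b) := by
  have h1 := P.ht_par b (by omega)
  rw [P.eq_of_ht (P.par b) (by omega), P.rt_par b (by omega)]

lemma dist_branch (hG : G.Connected) (hg : 3 ≤ g) {b x s : V} (hb : P.ht b = 1)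
    (hx : P.Desc b x) (hs : ¬ P.Desc b s) :
    G.dist s x = P.ht s + cd (P.rt s) (P.rt x) + P.ht x := by
  have h1 := dist_desc hG (by omega) hx hs
  have h2 := P.ht_par b (by omega)
  rw [par_eq_vc hb, dist_comm (v := vc (P.rt b)), dist_vc (P := P) hG hg, P.ht_vc, cd_comm,
    ← hx.rt_eq] at h1
  omega

lemma dist_of_rt_ne (hG : G.Connected) (hg : 3 ≤ g) {s x : V} (h : P.rt s ≠ P.rt x) :
    G.dist s x = P.ht s + cd (P.rt s) (P.rt x) + P.ht x := by
  by_cases h0 : P.ht x = 0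
  · rw [P.eq_of_ht x h0, dist_comm, dist_vc (P := P) hG hg, P.rt_vc, P.ht_vc, cd_comm]
    omega
  · obtain ⟨b, hb, hb1⟩ := exists_desc_ht (P := P) (n := 1) (x := x) (by omega)
    exact dist_branch hG hg hb1 hb (fun hs => h (hs.rt_eq.trans hb.rt_eq.symm))

lemma dist_within (hG : G.Connected) {b x s : V} (hs : P.Desc b s) (hx : P.Desc b x) :
    G.dist s x + 2 * P.ht b ≤ P.ht s + P.ht x := by
  have h1 := dist_anc hG hs
  have h2 := dist_anc hG hx
  have h3 : G.dist s x ≤ G.dist s b + G.dist b x := hG.dist_triangle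
  rw [dist_comm (u := s) (v := b)] at h3
  omega

lemma exists_fork {x y : V} (hrt : P.rt x = P.rt y) (hht : P.ht x = P.ht y) (hne : x ≠ y) :
    ∃ b c, b ≠ c ∧ 0 < P.ht b ∧ 0 < P.ht c ∧ P.par b = P.par c ∧ P.Desc b x ∧ P.Desc c y := by
  induction hn : P.ht x generalizing x y with
  | zero =>
    exact absurd ((P.eq_of_ht x hn).trans (hrt ▸ (P.eq_of_ht y (by omega)).symm)) hne
  | succ n ih =>
    by_cases h : P.par x = P.par y
    · exact ⟨x, y, hne, by omega, by omega, h, .refl, .refl⟩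
    · have h1 := P.ht_par x (by omega)
      have h2 := P.ht_par y (by omega)
      obtain ⟨b, c, hbc, hb, hc, hp, hx, hy⟩ := ih (x := P.par x) (y := P.par y)
        (by rw [P.rt_par x (by omega), P.rt_par y (by omega), hrt]) (by omega) h (by omega)
      exact ⟨b, c, hbc, hb, hc, hp, .step x (by omega) hx, .step y (by omega) hy⟩

/-- The edge from an off-cycle vertex to its parent. -/
abbrev tedge (P : Pres G g vc) (x : V) : Sym2 V := s(x, P.par x)

lemma edgeDist_mk (s u w : V) : edgeDist G s s(u, w) = min (G.dist s u) (G.dist s w) := rfl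

lemma edgeDist_tedge (hG : G.Connected) {x s : V} (hx : 0 < P.ht x) (hs : ¬ P.Desc x s) :
    edgeDist G s (P.tedge x) + 1 = G.dist s x := by
  rw [edgeDist_mk, dist_par hG hx hs]
  omega

lemma edgeDist_cycle (hG : G.Connected) (hg : 3 ≤ g) (s : V) (j : ZMod g) :
    edgeDist G s s(vc j, vc (j + 1)) = P.ht s + ced (P.rt s) j := by
  rw [edgeDist_mk, dist_comm, dist_vc (P := P) hG hg, dist_comm, dist_vc (P := P) hG hg]
  unfold ced
  rw [cd_comm, cd_comm (j + 1)]
  omega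

lemma edgeDist_within (hG : G.Connected) {b x s : V} (hs : P.Desc b s)
    (hx : P.Desc b x) : edgeDist G s (P.tedge x) + 2 * P.ht b ≤ P.ht s + P.ht x := by
  have h1 := dist_within hG hs hx
  rw [edgeDist_mk]
  omega

lemma tedge_injective {x y : V} (hx : 0 < P.ht x) (hy : 0 < P.ht y)
    (h : P.tedge x = P.tedge y) : x = y := by
  rw [Sym2.eq_iff] at h
  rcases h with ⟨h, -⟩ | ⟨h1, h2⟩
  · exact h
  · have h3 := P.ht_par x hx
    have h4 := P.ht_par y hy
    rw [h2] at h3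
    rw [← h1] at h4
    omega

lemma tedge_mem {x : V} (hx : 0 < P.ht x) : P.tedge x ∈ G.edgeSet := adj_par hx

end Pres

end Unicyclic

namespace Unicyclic

namespace Pres

variable {V : Type*} {G : SimpleGraph V} {g : ℕ} {vc : ZMod g → V} {P : Pres G g vc}

lemma not_cycleEdges_of_ht {x y : V} (hx : 0 < P.ht x) : s(x, y) ∉ cycleEdges g vc := by
  rintro ⟨i, hi⟩
  rw [Sym2.eq_iff] at hi
  rcases hi with ⟨rfl, -⟩ | ⟨rfl, -⟩ <;> rw [P.ht_vc] at hx <;> omega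

lemma inTree_iff (P : Pres G g vc) (i : ZMod g) (x : V) : inTree G g vc i x ↔ P.rt x = i := by
  constructor
  · intro h
    have key : ∀ u, (offCycle G g vc).Reachable u x → P.rt u = P.rt x := by
      clear h
      rintro u ⟨w⟩
      induction w with
      | nil => rfl
      | cons h _ ih =>
        rw [← ih]
        unfold offCycle at h
        rw [deleteEdges_adj] at h
        rcases (P.adj_iff _ _).1 h.1 with ⟨hx, rfl⟩ | ⟨hx, rfl⟩ | ⟨i, ⟨rfl, rfl⟩ | ⟨rfl, rfl⟩⟩
        · exact (P.rt_par _ hx).symm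
        · exact P.rt_par _ hx
        · exact absurd ⟨i, rfl⟩ h.2
        · exact absurd ⟨i, Sym2.eq_swap⟩ h.2
    rw [← key _ h, P.rt_vc]
  · rintro rfl
    unfold inTree
    induction hn : P.ht x generalizing x with
    | zero => nth_rewrite 2 [P.eq_of_ht x hn]; exact Reachable.refl _
    | succ n ih =>
      have hx : 0 < P.ht x := by omega
      have h1 := P.ht_par x hx
      have h2 := ih (P.par x) (by omega)
      rw [P.rt_par x hx] at h2
      refine h2.trans (Adj.reachable ?_)
      unfold offCycle
      rw [deleteEdges_adj]
      refine ⟨(adj_par hx).symm, ?_⟩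
      rw [Sym2.eq_swap]
      exact not_cycleEdges_of_ht hx

lemma sActive_iff (P : Pres G g vc) (S : Set V) (i : ZMod g) :
    SActive G g vc S i ↔ ∃ s ∈ S, P.rt s = i := by
  unfold SActive
  simp only [P.inTree_iff]

/-- `P.Leg x t` says that the descendants of the off-cycle vertex `x` form a path starting at `x`,
listed in order by `t`. -/
inductive Leg (P : Pres G g vc) : V → List V → Prop
  | single (x : V) : 0 < P.ht x → (∀ c, 0 < P.ht c → P.par c ≠ x) → Leg P x [x]
  | cons (x y : V) (t : List V) : 0 < P.ht x → 0 < P.ht y → P.par y = x →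
      (∀ c, 0 < P.ht c → P.par c = x → c = y) → Leg P y t → Leg P x (x :: t)

lemma Leg.ht_pos {x : V} {t : List V} (h : P.Leg x t) : 0 < P.ht x := by
  cases h <;> assumption

lemma Leg.head {x : V} {t : List V} (h : P.Leg x t) : ∃ r, t = x :: r := by
  cases h
  · exact ⟨_, rfl⟩
  · exact ⟨_, rfl⟩

lemma Leg.mem_iff {x : V} {t : List V} (h : P.Leg x t) (z : V) : z ∈ t ↔ P.Desc x z := by
  induction h with
  | single x hx hc =>
    rw [List.mem_singleton]
    constructor
    · rintro rfl; exact .refl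
    · intro h
      rcases h.cases_down with h | ⟨c, hc0, hcx, -⟩
      · exact h.symm
      · exact absurd hcx (hc c hc0)
  | cons x y t hx hy hyx huniq _ ih =>
    rw [List.mem_cons, ih]
    constructor
    · rintro (rfl | h)
      · exact .refl
      · exact (hyx ▸ desc_par hy).trans h
    · intro h
      rcases h.cases_down with h | ⟨c, hc0, hcx, hcz⟩
      · exact Or.inl h.symm
      · rw [huniq c hc0 hcx] at hcz
        exact Or.inr hcz

lemma Leg.unique {x : V} {t t' : List V} (h : P.Leg x t) (h' : P.Leg x t') : t = t' := by
  induction h generalizing t' with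
  | single x hx hc =>
    cases h' with
    | single => rfl
    | cons _ y _ _ hy hyx _ _ => exact absurd hyx (hc y hy)
  | cons x y t hx hy hyx huniq _ ih =>
    cases h' with
    | single _ _ hc => exact absurd hyx (hc y hy)
    | cons _ z _ _ hz hzx _ hl =>
      rw [huniq z hz hzx] at hl
      rw [ih hl]

lemma Leg.ht_lt {x z : V} {t : List V} (h : P.Leg x t) (hz : P.Desc x z) :
    P.ht z < P.ht x + t.length := by
  induction h with
  | single x hx hc =>
    rcases hz.cases_down with h | ⟨c, hc0, hcx, -⟩
    · simp [h]
    · exact absurd hcx (hc c hc0)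
  | cons x y t hx hy hyx huniq _ ih =>
    rw [List.length_cons]
    rcases hz.cases_down with h | ⟨c, hc0, hcx, hcz⟩
    · simp [h]
    · rw [huniq c hc0 hcx] at hcz
      have := ih hcz
      have := P.ht_par y hy
      rw [hyx] at this
      omega

lemma Leg.exists_at {x : V} {t : List V} (h : P.Leg x t) {m : ℕ} (hm : m < t.length) :
    ∃ z, P.Desc x z ∧ P.ht z = P.ht x + m := by
  induction h generalizing m with
  | single x hx hc => exact ⟨x, .refl, by simp at hm; omega⟩
  | cons x y t hx hy hyx huniq _ ih =>
    cases m with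
    | zero => exact ⟨x, .refl, rfl⟩
    | succ m =>
      rw [List.length_cons] at hm
      obtain ⟨z, hz, hzm⟩ := ih (m := m) (by omega)
      have := P.ht_par y hy
      rw [hyx] at this
      exact ⟨z, (hyx ▸ desc_par hy).trans hz, by omega⟩

variable [Fintype V] [DecidableEq V]

/-- The children of a vertex. -/
def kids (P : Pres G g vc) (x : V) : Finset V :=
  Finset.univ.filter fun c => 0 < P.ht c ∧ P.par c = x

lemma mem_kids {x c : V} : c ∈ P.kids x ↔ 0 < P.ht c ∧ P.par c = x := by
  simp [kids]

variable [DecidableRel G.Adj]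

lemma degree_off {x : V} (hx : 0 < P.ht x) : G.degree x = (P.kids x).card + 1 := by
  rw [← card_neighborFinset_eq_degree]
  have : G.neighborFinset x = insert (P.par x) (P.kids x) := by
    ext y
    rw [mem_neighborFinset, Finset.mem_insert, mem_kids]
    constructor
    · intro h
      rcases adj_cases (P := P) h with h | h | h
      · exact Or.inl h.2.symm
      · exact Or.inr h
      · omega
    · rintro (rfl | ⟨hy, rfl⟩)
      · exact adj_par hx
      · exact (adj_par hy).symm
  rw [this, Finset.card_insert_of_notMem]
  rw [mem_kids]
  rintro ⟨h1, h2⟩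
  have h3 := P.ht_par x hx
  have h4 := P.ht_par _ h1
  rw [h2] at h4
  omega

lemma degree_on (hg : 3 ≤ g) {x : V} (hx : P.ht x = 0) : G.degree x = (P.kids x).card + 2 := by
  have hxv := P.eq_of_ht x hx
  rw [← card_neighborFinset_eq_degree]
  have : G.neighborFinset x =
      insert (vc (P.rt x + 1)) (insert (vc (P.rt x - 1)) (P.kids x)) := by
    ext y
    rw [mem_neighborFinset, Finset.mem_insert, Finset.mem_insert, mem_kids]
    constructor
    · intro h
      rcases adj_cases (P := P) h with h | h | ⟨-, hy, h⟩
      · omega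
      · exact Or.inr (Or.inr h)
      · rcases h with h | h
        · left; rw [← h]; exact P.eq_of_ht y hy
        · right; left; rw [h, add_sub_cancel_right]; exact P.eq_of_ht y hy
    · rintro (rfl | rfl | ⟨hy, rfl⟩)
      · exact (P.adj_iff _ _).2 (Or.inr (Or.inr ⟨_, Or.inl ⟨hxv, rfl⟩⟩))
      · exact (P.adj_iff _ _).2 (Or.inr (Or.inr ⟨_, Or.inr ⟨rfl, by
          rw [sub_add_cancel]; exact hxv⟩⟩))
      · exact (adj_par hy).symm
  have hk : ∀ i, vc i ∉ P.kids x := by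
    intro i hi
    rw [mem_kids, P.ht_vc] at hi
    omega
  rw [this, Finset.card_insert_of_notMem, Finset.card_insert_of_notMem (hk _)]
  rw [Finset.mem_insert, not_or]
  refine ⟨fun h => ?_, hk _⟩
  have h1 := congrArg P.rt h
  rw [P.rt_vc, P.rt_vc] at h1
  apply two_ne_zero_zmod hg
  linear_combination h1

lemma three_le_degree_of_fork (hg : 3 ≤ g) {b c : V} (hbc : b ≠ c) (hb : 0 < P.ht b)
    (hc : 0 < P.ht c) (h : P.par b = P.par c) : 3 ≤ G.degree (P.par b) := by
  have : ({b, c} : Finset V) ⊆ P.kids (P.par b) := by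
    intro x hx
    rw [Finset.mem_insert, Finset.mem_singleton] at hx
    rcases hx with rfl | rfl
    · exact mem_kids.2 ⟨hb, rfl⟩
    · exact mem_kids.2 ⟨hc, h.symm⟩
  have := Finset.card_le_card this
  rw [Finset.card_pair hbc] at this
  by_cases h0 : 0 < P.ht (P.par b)
  · rw [degree_off h0]; omega
  · rw [degree_on hg (by omega : P.ht (P.par b) = 0)]; omega

lemma branching_of_fork (hg : 3 ≤ g) {b c : V} (hbc : b ≠ c) (hb : 0 < P.ht b)
    (hc : 0 < P.ht c) (h : P.par b = P.par c) : Branching G g vc (P.par b) := by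
  have h3 := three_le_degree_of_fork hg hbc hb hc h
  by_cases h0 : 0 < P.ht (P.par b)
  · left
    refine ⟨?_, h3⟩
    rintro ⟨i, hi⟩
    rw [← hi, P.ht_vc] at h0
    omega
  · right
    have h0 : P.ht (P.par b) = 0 := by omega
    refine ⟨⟨_, (P.eq_of_ht _ h0).symm⟩, ?_⟩
    have : ({b, c} : Finset V) ⊆ P.kids (P.par b) := by
      intro x hx
      rw [Finset.mem_insert, Finset.mem_singleton] at hx
      rcases hx with rfl | rfl
      · exact mem_kids.2 ⟨hb, rfl⟩
      · exact mem_kids.2 ⟨hc, h.symm⟩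
    have := Finset.card_le_card this
    rw [Finset.card_pair hbc] at this
    rw [degree_on hg h0]; omega

lemma fork_of_branching (hg : 3 ≤ g) {x : V} (h : Branching G g vc x) :
    ∃ b c, b ≠ c ∧ 0 < P.ht b ∧ 0 < P.ht c ∧ P.par b = x ∧ P.par c = x := by
  have : 1 < (P.kids x).card := by
    rcases h with ⟨h1, h2⟩ | ⟨⟨i, rfl⟩, h2⟩
    · have h0 : 0 < P.ht x := by
        by_contra h0
        exact h1 ⟨_, (P.eq_of_ht x (by omega)).symm⟩
      rw [degree_off h0] at h2; omega
    · rw [degree_on hg (P.ht_vc i)] at h2; omega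
  obtain ⟨b, hb, c, hc, hbc⟩ := Finset.one_lt_card.1 this
  rw [mem_kids] at hb hc
  exact ⟨b, c, hbc, hb.1, hc.1, hb.2, hc.2⟩

lemma leg_of_tail (hg : 3 ≤ g) {v x : V} {r : List V} (hnd : (x :: r).Nodup) (hv : v ∉ x :: r)
    (hadj : G.Adj v x) (hch : List.IsChain G.Adj (x :: r))
    (hlast : ∀ u ∈ (x :: r).getLast?, G.degree u = 1)
    (hmid : ∀ u ∈ (x :: r).dropLast, G.degree u = 2) : P.Leg x (x :: r) ∧ P.par x = v := by
  induction r generalizing v x with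
  | nil =>
    have h1 := hlast x (by simp)
    have hx : 0 < P.ht x := by
      by_contra h0
      rw [degree_on hg (by omega : P.ht x = 0)] at h1
      omega
    rw [degree_off hx] at h1
    have hk : P.kids x = ∅ := by rw [← Finset.card_eq_zero]; omega
    have hno : ∀ c, 0 < P.ht c → P.par c ≠ x := by
      intro c hc hcx
      have : c ∈ P.kids x := mem_kids.2 ⟨hc, hcx⟩
      rw [hk] at this
      simp at this
    refine ⟨.single x hx hno, ?_⟩
    rcases adj_cases (P := P) hadj with h | h | h
    · exact absurd h.2 (hno v h.1)
    · exact h.2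
    · omega
  | cons y r ih =>
    rw [List.isChain_cons_cons] at hch
    have hxr : x ∉ y :: r := (List.nodup_cons.1 hnd).1
    have hvx : v ≠ y := by rintro rfl; simp at hv
    obtain ⟨hl, hyx⟩ := ih (v := x) (x := y) (List.nodup_cons.1 hnd).2 hxr hch.1 hch.2
      (fun u hu => hlast u (by simpa [List.getLast?_cons_cons] using hu))
      (fun u hu => hmid u (by rw [List.dropLast_cons_cons]; exact List.mem_cons_of_mem _ hu))
    have h2 := hmid x (by simp)
    have hyk : y ∈ P.kids x := mem_kids.2 ⟨hl.ht_pos, hyx⟩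
    have hpos : 0 < (P.kids x).card := Finset.card_pos.2 ⟨y, hyk⟩
    have hx : 0 < P.ht x := by
      by_contra h0
      rw [degree_on hg (by omega : P.ht x = 0)] at h2
      omega
    rw [degree_off hx] at h2
    have huniq : ∀ c, 0 < P.ht c → P.par c = x → c = y := fun c hc hcx =>
      Finset.card_le_one.1 (by omega : (P.kids x).card ≤ 1) c (mem_kids.2 ⟨hc, hcx⟩) y hyk
    refine ⟨.cons x y _ hx hl.ht_pos hyx huniq hl, ?_⟩
    rcases adj_cases (P := P) hadj with h | h | h
    · exact absurd (huniq v h.1 h.2) hvx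
    · exact h.2
    · omega

lemma Leg.tail_props {x : V} {t : List V} (h : P.Leg x t) :
    t.Nodup ∧ List.IsChain G.Adj t ∧ (∀ u ∈ t.getLast?, G.degree u = 1) ∧
      ∀ u ∈ t.dropLast, G.degree u = 2 := by
  induction h with
  | single x hx hc =>
    refine ⟨by simp, by simp, ?_, by simp⟩
    intro u hu
    simp only [List.getLast?_singleton, Option.mem_def, Option.some.injEq] at hu
    subst hu
    rw [degree_off hx, Nat.add_eq_right, Finset.card_eq_zero, Finset.eq_empty_iff_forall_notMem]
    intro c hcm
    rw [mem_kids] at hcm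
    exact hc c hcm.1 hcm.2
  | cons x y t hx hy hyx huniq hl ih =>
    obtain ⟨r, rfl⟩ := hl.head
    obtain ⟨h1, h2, h3, h4⟩ := ih
    refine ⟨List.nodup_cons.2 ⟨?_, h1⟩, List.isChain_cons_cons.2 ⟨?_, h2⟩, ?_, ?_⟩
    · rw [hl.mem_iff]
      intro hd
      have := hd.ht_le
      have := P.ht_par y hy
      rw [hyx] at this
      omega
    · exact hyx ▸ (adj_par hy).symm
    · intro u hu
      exact h3 u (by simpa [List.getLast?_cons_cons] using hu)
    · intro u hu
      rw [List.dropLast_cons_cons, List.mem_cons] at hu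
      rcases hu with rfl | hu
      · have : P.kids u = {y} := by
          ext c
          rw [mem_kids, Finset.mem_singleton]
          exact ⟨fun h => huniq c h.1 h.2, by rintro rfl; exact ⟨hy, hyx⟩⟩
        rw [degree_off hx, this, Finset.card_singleton]
      · exact h4 u hu

end Pres

end Unicyclic

namespace Unicyclic

namespace Pres

variable {V : Type*} {G : SimpleGraph V} {g : ℕ} {vc : ZMod g → V} {P : Pres G g vc}
  [Fintype V] [DecidableEq V] [DecidableRel G.Adj] {S : Set V}

lemma isThreadAt_iff (P : Pres G g vc) (hg : 3 ≤ g) (v : V) (t : List V) : IsThreadAt G v t ↔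
    3 ≤ G.degree v ∧ ∃ c, 0 < P.ht c ∧ P.par c = v ∧ P.Leg c t := by
  constructor
  · rintro ⟨hne, hnd, hv, hd, hch, hhead, hlast, hmid⟩
    refine ⟨hd, ?_⟩
    obtain ⟨x, r, rfl⟩ := List.exists_cons_of_ne_nil hne
    obtain ⟨hl, hp⟩ := leg_of_tail (P := P) hg hnd hv (hhead x (by simp)) hch hlast hmid
    exact ⟨x, hl.ht_pos, hp, hl⟩
  · rintro ⟨hd, c, hc, rfl, hl⟩
    obtain ⟨h1, h2, h3, h4⟩ := hl.tail_props
    refine ⟨?_, h1, ?_, hd, h2, ?_, h3, h4⟩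
    · obtain ⟨r, rfl⟩ := hl.head
      exact List.cons_ne_nil _ _
    · rw [hl.mem_iff]
      intro h
      have := h.ht_le
      have := P.ht_par c hc
      omega
    · obtain ⟨r, rfl⟩ := hl.head
      intro u hu
      simp only [List.head?_cons, Option.mem_def, Option.some.injEq] at hu
      subst hu
      exact (adj_par hc).symm

lemma Leg.degree_le {x z : V} {t : List V} (h : P.Leg x t) (hz : P.Desc x z) :
    G.degree z ≤ 2 := by
  obtain ⟨-, -, h3, h4⟩ := h.tail_props
  have hne : t ≠ [] := by
    obtain ⟨r, rfl⟩ := h.head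
    exact List.cons_ne_nil _ _
  rw [← h.mem_iff, ← List.dropLast_append_getLast hne, List.mem_append, List.mem_singleton] at hz
  rcases hz with hz | rfl
  · exact (h4 z hz).le
  · rw [h3 _ (List.getLast?_eq_some_getLast hne)]
    omega

lemma thread_eq_of_mem (P : Pres G g vc) (hg : 3 ≤ g) {v v' s : V} {t t' : List V}
    (h : IsThreadAt G v t) (h' : IsThreadAt G v' t') (hs : s ∈ t) (hs' : s ∈ t') :
    v = v' ∧ t = t' := by
  obtain ⟨hd, c, hc, rfl, hl⟩ := (P.isThreadAt_iff hg v t).1 h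
  obtain ⟨hd', c', hc', rfl, hl'⟩ := (P.isThreadAt_iff hg v' t').1 h'
  have hcs := (hl.mem_iff s).1 hs
  have hcs' := (hl'.mem_iff s).1 hs'
  have : c = c' := by
    rcases hcs.comparable hcs' with h | h
    · rcases h.cases_up with h | ⟨-, h⟩
      · exact h
      · have := hl.degree_le h
        omega
    · rcases h.cases_up with h | ⟨-, h⟩
      · exact h.symm
      · have := hl'.degree_le h
        omega
  subst this
  exact ⟨rfl, hl.unique hl'⟩

lemma false_of_free_legs (hg : 3 ≤ g) (hS : BranchResolving G S) {b c : V} {t t' : List V}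
    (hbc : b ≠ c) (hp : P.par b = P.par c) (hb : P.Leg b t) (hc : P.Leg c t')
    (hbS : ∀ s ∈ S, ¬ P.Desc b s) (hcS : ∀ s ∈ S, ¬ P.Desc c s) : False := by
  have hd := three_le_degree_of_fork hg hbc hb.ht_pos hc.ht_pos hp
  have hne : t ≠ t' := by
    rintro rfl
    obtain ⟨r, hr⟩ := hb.head
    obtain ⟨r', hr'⟩ := hc.head
    rw [hr] at hr'
    injection hr' with h
    exact hbc h
  rcases hS (P.par b) t t' ((P.isThreadAt_iff hg _ _).2 ⟨hd, b, hb.ht_pos, rfl, hb⟩)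
    ((P.isThreadAt_iff hg _ _).2 ⟨hd, c, hc.ht_pos, hp.symm, hc⟩) hne with
    ⟨s, hs, hst⟩ | ⟨s, hs, hst⟩
  · exact hbS s hs ((hb.mem_iff s).1 hst)
  · exact hcS s hs ((hc.mem_iff s).1 hst)

lemma exists_leg (hg : 3 ≤ g) (hS : BranchResolving G S) {b : V} (hb : 0 < P.ht b)
    (hbS : ∀ s ∈ S, ¬ P.Desc b s) : ∃ t, P.Leg b t := by
  obtain ⟨N, hN⟩ : ∃ N, ∀ x, P.ht x ≤ N :=
    ⟨Finset.univ.sup P.ht, fun x => Finset.le_sup (f := P.ht) (Finset.mem_univ x)⟩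
  induction hn : N - P.ht b using Nat.strong_induction_on generalizing b with
  | _ n ih =>
    have hkid : ∀ c, 0 < P.ht c → P.par c = b → (∀ s ∈ S, ¬ P.Desc c s) ∧ ∃ t, P.Leg c t := by
      intro c hc hcb
      have h1 := P.ht_par c hc
      have h2 := hN c
      rw [hcb] at h1
      have hfree : ∀ s ∈ S, ¬ P.Desc c s := fun s hs h =>
        hbS s hs ((hcb ▸ desc_par hc).trans h)
      exact ⟨hfree, ih (N - P.ht c) (by omega) hc hfree rfl⟩
    by_cases hk : ∃ y, 0 < P.ht y ∧ P.par y = b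
    · obtain ⟨y, hy, hyb⟩ := hk
      obtain ⟨hyS, t, ht⟩ := hkid y hy hyb
      refine ⟨b :: t, .cons b y t hb hy hyb (fun c hc hcb => ?_) ht⟩
      by_contra hne
      obtain ⟨hcS, t', ht'⟩ := hkid c hc hcb
      exact false_of_free_legs hg hS hne (hcb.trans hyb.symm) ht' ht hcS hyS
    · push Not at hk
      exact ⟨[b], .single b hb hk⟩

lemma exists_desc_of_fork (hg : 3 ≤ g) (hS : BranchResolving G S) {b c : V} (hbc : b ≠ c)
    (hb : 0 < P.ht b) (hc : 0 < P.ht c) (hp : P.par b = P.par c) :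
    ∃ s ∈ S, P.Desc b s ∨ P.Desc c s := by
  by_contra hcon
  push Not at hcon
  obtain ⟨t, ht⟩ := exists_leg hg hS hb (fun s hs => (hcon s hs).1)
  obtain ⟨t', ht'⟩ := exists_leg hg hS hc (fun s hs => (hcon s hs).2)
  exact false_of_free_legs hg hS hbc hp ht ht' (fun s hs => (hcon s hs).1)
    (fun s hs => (hcon s hs).2)

lemma sActive_of_branchActive (P : Pres G g vc) (hg : 3 ≤ g) (hS : BranchResolving G S)
    {i : ZMod g} (h : BranchActive G g vc i) : SActive G g vc S i := by
  obtain ⟨x, hx, hbr⟩ := h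
  rw [P.inTree_iff] at hx
  obtain ⟨b, c, hbc, hb, hc, rfl, hcb⟩ := fork_of_branching (P := P) hg hbr
  obtain ⟨s, hs, hd⟩ := exists_desc_of_fork hg hS hbc hb hc hcb.symm
  rw [P.sActive_iff]
  refine ⟨s, hs, ?_⟩
  rcases hd with hd | hd
  · rw [hd.rt_eq, ← P.rt_par b hb, hx]
  · rw [hd.rt_eq, ← P.rt_par c hc, hcb, hx]

lemma branchActive_of_sActive (P : Pres G g vc) (hg : 3 ≤ g) {S : Finset V} (hS : SmallestBR G S)
    {i : ZMod g} (h : SActive G g vc (↑S) i) : BranchActive G g vc i := by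
  rw [P.sActive_iff] at h
  obtain ⟨s, hs, rfl⟩ := h
  have hs : s ∈ S := hs
  have hnot : ¬ BranchResolving G (↑(S.erase s) : Set V) := fun hbr => by
    have := hS.2 _ hbr
    have := Finset.card_erase_lt_of_mem hs
    omega
  unfold BranchResolving at hnot
  push Not at hnot
  obtain ⟨v, t₁, t₂, h₁, h₂, hne, hf₁, hf₂⟩ := hnot
  have key : ∀ t : List V, (∀ x ∈ (↑(S.erase s) : Set V), x ∉ t) → ∀ x ∈ (S : Set V), x ∈ t →
      s ∈ t := by
    intro t ht x hx hxt
    by_cases hxs : x = s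
    · exact hxs ▸ hxt
    · exact absurd hxt (ht x (by simpa using ⟨hx, hxs⟩))
  have hrt : P.rt s = P.rt v := by
    rcases hS.1 v t₁ t₂ h₁ h₂ hne with ⟨x, hx, hxt⟩ | ⟨x, hx, hxt⟩
    · obtain ⟨-, c, hc, rfl, hl⟩ := (P.isThreadAt_iff hg v t₁).1 h₁
      rw [((hl.mem_iff s).1 (key t₁ hf₁ x hx hxt)).rt_eq, P.rt_par c hc]
    · obtain ⟨-, c, hc, rfl, hl⟩ := (P.isThreadAt_iff hg v t₂).1 h₂
      rw [((hl.mem_iff s).1 (key t₂ hf₂ x hx hxt)).rt_eq, P.rt_par c hc]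
  refine ⟨v, by rw [P.inTree_iff, hrt], ?_⟩
  obtain ⟨-, b, hb, rfl, hl⟩ := (P.isThreadAt_iff hg _ t₁).1 h₁
  obtain ⟨-, c, hc, hcb, hl'⟩ := (P.isThreadAt_iff hg _ t₂).1 h₂
  refine branching_of_fork hg (c := c) ?_ hb hc hcb.symm
  rintro rfl
  exact hne (hl.unique hl')

lemma exists_free_thread (P : Pres G g vc) (hg : 3 ≤ g) {S : Finset V} (hS : SmallestBR G S)
    {v : V} {t : List V} (h : IsThreadAt G v t) :
    ∃ t', IsThreadAt G v t' ∧ SFree (↑S) t' := by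
  by_contra hcon
  have hhit : ∀ t', IsThreadAt G v t' → ∃ s ∈ S, s ∈ t' := by
    intro t' ht'
    by_contra hno
    push Not at hno
    exact hcon ⟨t', ht', fun u hu hus => hno u hus hu⟩
  obtain ⟨s, hs, hst⟩ := hhit t h
  have hbr : BranchResolving G (↑(S.erase s) : Set V) := by
    have key : ∀ v' t', IsThreadAt G v' t' → ¬ (v = v' ∧ t = t') → (∃ x ∈ (S : Set V), x ∈ t') →
        ∃ x ∈ (↑(S.erase s) : Set V), x ∈ t' := by
      rintro v' t' h' hne ⟨x, hx, hxt⟩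
      refine ⟨x, ?_, hxt⟩
      have hxs : x ≠ s := by
        rintro rfl
        exact hne (P.thread_eq_of_mem hg h h' hst hxt)
      simpa using ⟨hx, hxs⟩
    intro v' t₁ t₂ h₁ h₂ hne
    by_cases hv : v = v'
    · subst hv
      by_cases ht : t = t₁
      · exact Or.inr (key v t₂ h₂ (fun h => hne (ht.symm.trans h.2)) (hhit t₂ h₂))
      · exact Or.inl (key v t₁ h₁ (fun h => ht h.2) (hhit t₁ h₁))
    · rcases hS.1 v' t₁ t₂ h₁ h₂ hne with hx | hx
      · exact Or.inl (key v' t₁ h₁ (fun h => hv h.1) hx)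
      · exact Or.inr (key v' t₂ h₂ (fun h => hv h.1) hx)
  have := hS.2 _ hbr
  have := Finset.card_erase_lt_of_mem hs
  omega

lemma branchResolving_of_heads (P : Pres G g vc) (hg : 3 ≤ g)
    (h : ∀ b c, b ≠ c → 0 < P.ht b → 0 < P.ht c → P.par b = P.par c →
      ∃ s ∈ S, P.Desc b s ∨ P.Desc c s) : BranchResolving G S := by
  intro v t t' ht ht' hne
  obtain ⟨-, b, hb, rfl, hl⟩ := (P.isThreadAt_iff hg _ t).1 ht
  obtain ⟨-, c, hc, hcb, hl'⟩ := (P.isThreadAt_iff hg _ t').1 ht'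
  obtain ⟨s, hs, hd⟩ := h b c (by rintro rfl; exact hne (hl.unique hl')) hb hc hcb.symm
  rcases hd with hd | hd
  · exact Or.inl ⟨s, hs, (hl.mem_iff s).2 hd⟩
  · exact Or.inr ⟨s, hs, (hl'.mem_iff s).2 hd⟩

lemma branchResolving_of_isVertexMG (P : Pres G g vc) (hG : G.Connected) (hg : 3 ≤ g)
    (h : IsVertexMG G S) : BranchResolving G S := by
  refine P.branchResolving_of_heads hg fun b c hbc hb hc hp => ?_
  obtain ⟨s, hs, hd⟩ := h b c hbc
  refine ⟨s, hs, ?_⟩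
  by_contra hcon
  rw [not_or] at hcon
  rw [dist_par hG hb hcon.1, dist_par hG hc hcon.2, hp] at hd
  exact hd rfl

lemma branchResolving_of_isEdgeMG (P : Pres G g vc) (hG : G.Connected) (hg : 3 ≤ g)
    (h : IsEdgeMG G S) : BranchResolving G S := by
  refine P.branchResolving_of_heads hg fun b c hbc hb hc hp => ?_
  obtain ⟨s, hs, hd⟩ := h (P.tedge b) (tedge_mem hb) (P.tedge c) (tedge_mem hc)
    (fun he => hbc (tedge_injective hb hc he))
  refine ⟨s, hs, ?_⟩
  by_contra hcon
  rw [not_or] at hcon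
  have h1 := edgeDist_tedge hG hb hcon.1
  have h2 := edgeDist_tedge hG hc hcon.2
  rw [dist_par hG hb hcon.1] at h1
  rw [dist_par hG hc hcon.2, ← hp] at h2
  omega

end Pres

end Unicyclic

namespace Unicyclic

/-- An abstract form of failing to be a vertex metric generator: `A` is the set of active cycle
positions and `F i p` says that a point at height `p` can be reached freely above position `i`. -/
def VBad {g : ℕ} (A : ZMod g → Prop) (F : ZMod g → ℕ → Prop) : Prop :=
  ∃ i j p, i ≠ j ∧ F i p ∧ ∀ l, A l → cd l j = cd l i + p

/-- An abstract form of failing to be an edge metric generator: the two undistinguished edges are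
both off the cycle, one off and one on the cycle, or both on the cycle. -/
def EBad {g : ℕ} (A : ZMod g → Prop) (F : ZMod g → ℕ → Prop) : Prop :=
  (∃ i j p q, i ≠ j ∧ F i (p + 1) ∧ F j (q + 1) ∧ ∀ l, A l → cd l i + p = cd l j + q) ∨
    (∃ i j p, F i (p + 1) ∧ ∀ l, A l → cd l i + p = ced l j) ∨
      ∃ i j : ZMod g, i ≠ j ∧ ∀ l, A l → ced l i = ced l j

/-- Either `p = 0` or an `S`-free thread of length at least `p` hangs at `v_i`. -/
def FreeAt {V : Type*} [Fintype V] [DecidableEq V] (G : SimpleGraph V) [DecidableRel G.Adj] {g : ℕ}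
    (vc : ZMod g → V) (S : Set V) (i : ZMod g) (p : ℕ) : Prop :=
  p = 0 ∨ ∃ t : List V, IsThreadAt G (vc i) t ∧ SFree S t ∧ p ≤ t.length

lemma ced_le {g : ℕ} (hg : 3 ≤ g) (i j l : ZMod g) : ced l j ≤ cd l i + ced i j := by
  have h1 := cd_triangle hg l i j
  have h2 := cd_triangle hg l i (j + 1)
  unfold ced
  omega

namespace Pres

section

variable {V : Type*} {G : SimpleGraph V} {g : ℕ} {vc : ZMod g → V} {P : Pres G g vc} {S : Set V}

/-- `D` behaves like the distance to a point at height `η` above the cycle position `i`. -/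
def IsTreeDist (P : Pres G g vc) (D : V → ℕ) (i : ZMod g) (η : ℕ) : Prop :=
  ∀ s, D s ≤ P.ht s + cd (P.rt s) i + η ∧
    (P.rt s ≠ i → D s = P.ht s + cd (P.rt s) i + η)

lemma IsTreeDist.exact {D E : V → ℕ} {i : ZMod g} {η : ℕ} {ψ : ZMod g → ℕ}
    (hA : ∀ i, ∃ s ∈ S, P.rt s ≠ i) (hD : P.IsTreeDist D i η)
    (hE : ∀ s ∈ S, E s = P.ht s + ψ (P.rt s)) (hψ : ∀ l, ψ l ≤ cd l i + ψ i)
    (h : ∀ s ∈ S, D s = E s) : ∀ s ∈ S, D s = P.ht s + cd (P.rt s) i + η := by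
  intro s hs
  by_cases hi : P.rt s = i
  · obtain ⟨s', hs', hne⟩ := hA i
    have h1 := (hD s).1
    have h2 := (hD s').2 hne
    have h3 := hψ (P.rt s')
    have h4 := hE s hs
    have h5 := hE s' hs'
    rw [← h s hs, hi] at h4
    rw [← h s' hs'] at h5
    rw [hi, cd_self] at h1 ⊢
    omega
  · exact (hD s).2 hi

lemma IsTreeDist.exact_pair (hg : 3 ≤ g) {D E : V → ℕ} {i j : ZMod g} {η θ : ℕ} (hij : i ≠ j)
    (hA : ∀ i, ∃ s ∈ S, P.rt s ≠ i) (hD : P.IsTreeDist D i η) (hE : P.IsTreeDist E j θ)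
    (h : ∀ s ∈ S, D s = E s) : (∀ s ∈ S, D s = P.ht s + cd (P.rt s) i + η) ∧
      ∀ s ∈ S, E s = P.ht s + cd (P.rt s) j + θ := by
  have tri : ∀ (a b : ZMod g) (c : ℕ) (l : ZMod g), cd l a + c ≤ cd l b + (cd b a + c) := by
    intro a b c l
    have := cd_triangle hg l b a
    omega
  have hDE : (∀ s ∈ S, D s = P.ht s + cd (P.rt s) i + η) →
      ∀ s ∈ S, E s = P.ht s + cd (P.rt s) j + θ := fun hx =>
    hE.exact hA (E := D) (ψ := fun l => cd l i + η) (fun s hs => by rw [hx s hs, add_assoc])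
      (tri i j η) (fun s hs => (h s hs).symm)
  have hED : (∀ s ∈ S, E s = P.ht s + cd (P.rt s) j + θ) →
      ∀ s ∈ S, D s = P.ht s + cd (P.rt s) i + η := fun hx =>
    hD.exact hA (E := E) (ψ := fun l => cd l j + θ) (fun s hs => by rw [hx s hs, add_assoc])
      (tri j i θ) h
  by_cases hx : ∀ s ∈ S, D s = P.ht s + cd (P.rt s) i + η
  · exact ⟨hx, hDE hx⟩
  by_cases hy : ∀ s ∈ S, E s = P.ht s + cd (P.rt s) j + θ
  · exact ⟨hED hy, hy⟩
  exfalso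
  push Not at hx hy
  obtain ⟨s, hs, hsD⟩ := hx
  obtain ⟨s', hs', hsE⟩ := hy
  have hsi : P.rt s = i := by
    by_contra hne
    exact hsD ((hD s).2 hne)
  have hsj : P.rt s' = j := by
    by_contra hne
    exact hsE ((hE s').2 hne)
  have h1 := (hD s).1
  have h2 := (hE s).2 (by rwa [hsi])
  have h3 := (hE s').1
  have h4 := (hD s').2 (by rw [hsj]; exact hij.symm)
  rw [h s hs, hsi, cd_self] at h1 hsD
  rw [← h s' hs', hsj, cd_self] at h3 hsE
  rw [hsi] at h2
  rw [hsj] at h4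
  omega

lemma isTreeDist_dist (hG : G.Connected) (hg : 3 ≤ g) (x : V) :
    P.IsTreeDist (fun s => G.dist s x) (P.rt x) (P.ht x) :=
  fun s => ⟨dist_le hG hg s x, dist_of_rt_ne hG hg⟩

lemma isTreeDist_tedge (hG : G.Connected) (hg : 3 ≤ g) {x : V} (hx : 0 < P.ht x) :
    P.IsTreeDist (fun s => edgeDist G s (P.tedge x)) (P.rt x) (P.ht x - 1) := by
  intro s
  constructor
  · have h1 := dist_le (P := P) hG hg s (P.par x)
    have h2 := P.ht_par x hx
    rw [P.rt_par x hx] at h1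
    simp only [edgeDist_mk]
    omega
  · intro h
    have h1 := edgeDist_tedge (P := P) (x := x) (s := s) hG hx (fun hd => h hd.rt_eq)
    have h2 := dist_of_rt_ne (P := P) hG hg h
    simp only
    omega

lemma dist_fork (hG : G.Connected) {b c x y s : V} (hbc : b ≠ c) (hb : 0 < P.ht b)
    (hc : 0 < P.ht c) (hp : P.par b = P.par c) (hx : P.Desc b x) (hy : P.Desc c y)
    (hs : P.Desc b s) : ¬ P.Desc c s ∧ G.dist s x + 2 * P.ht b ≤ P.ht s + P.ht x ∧
      G.dist s y + 2 * P.ht b = P.ht s + P.ht y + 2 := by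
  have h1 := P.ht_par b hb
  have h2 := P.ht_par c hc
  have hcs : ¬ P.Desc c s := fun h => hbc (hs.eq_of_desc h (by rw [← h1, ← h2, hp]))
  have h3 := dist_within hG hs hx
  have h4 := dist_desc hG hc hy hcs
  have h5 := dist_anc hG ((desc_par hb).trans hs)
  rw [dist_comm] at h5
  rw [← hp] at h4
  exact ⟨hcs, h3, by omega⟩

lemma edge_cases (P : Pres G g vc) {e : Sym2 V} (he : e ∈ G.edgeSet) :
    (∃ x, 0 < P.ht x ∧ e = P.tedge x) ∨ ∃ j, e = s(vc j, vc (j + 1)) := by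
  induction e using Sym2.ind with
  | _ x y =>
    rcases (P.adj_iff x y).1 he with ⟨h, rfl⟩ | ⟨h, rfl⟩ | ⟨j, ⟨rfl, rfl⟩ | ⟨rfl, rfl⟩⟩
    · exact Or.inl ⟨x, h, rfl⟩
    · exact Or.inl ⟨y, h, Sym2.eq_swap⟩
    · exact Or.inr ⟨j, rfl⟩
    · exact Or.inr ⟨j, Sym2.eq_swap⟩

end

variable {V : Type*} {G : SimpleGraph V} {g : ℕ} {vc : ZMod g → V} {P : Pres G g vc}
  [Fintype V] [DecidableEq V] [DecidableRel G.Adj] {S : Set V}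

lemma freeAt_of_desc (hg : 3 ≤ g) (hS : BranchResolving G S) {b x : V} (hb : P.ht b = 1)
    (hx : P.Desc b x) (hfree : ∀ s ∈ S, ¬ P.Desc b s) : FreeAt G vc S (P.rt x) (P.ht x) := by
  obtain ⟨t, ht⟩ := exists_leg hg hS (by omega) hfree
  have hpar := par_eq_vc hb
  refine Or.inr ⟨t, ?_, fun u hu hus => hfree u hus ((ht.mem_iff u).1 hu), ?_⟩
  · rw [hx.rt_eq, ← hpar, P.isThreadAt_iff hg]
    refine ⟨?_, b, by omega, rfl, ht⟩
    rw [degree_on hg (by rw [hpar, P.ht_vc])]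
    have : 0 < (P.kids (P.par b)).card := Finset.card_pos.2 ⟨b, mem_kids.2 ⟨by omega, rfl⟩⟩
    omega
  · have := ht.ht_lt hx
    omega

lemma freeAt_of_exact (hG : G.Connected) (hg : 3 ≤ g) (hS : BranchResolving G S) {x : V}
    (h : ∀ s ∈ S, G.dist s x = P.ht s + cd (P.rt s) (P.rt x) + P.ht x) :
    FreeAt G vc S (P.rt x) (P.ht x) := by
  by_cases hx : P.ht x = 0
  · exact Or.inl hx
  · obtain ⟨b, hbx, hb⟩ := exists_desc_ht (P := P) (n := 1) (x := x) (by omega)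
    refine freeAt_of_desc hg hS hb hbx fun s hs hd => ?_
    have h1 := dist_within hG hd hbx
    have h2 := h s hs
    omega

lemma freeAt_of_edge_exact (hG : G.Connected) (hg : 3 ≤ g) (hS : BranchResolving G S) {x : V}
    (hx : 0 < P.ht x) (h : ∀ s ∈ S,
      edgeDist G s (P.tedge x) = P.ht s + cd (P.rt s) (P.rt x) + (P.ht x - 1)) :
    FreeAt G vc S (P.rt x) (P.ht x) := by
  obtain ⟨b, hbx, hb⟩ := exists_desc_ht (P := P) (n := 1) (x := x) (by omega)
  refine freeAt_of_desc hg hS hb hbx fun s hs hd => ?_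
  have h1 := edgeDist_within hG hd hbx
  have h2 := h s hs
  omega

lemma exists_of_freeAt (P : Pres G g vc) (hG : G.Connected) (hg : 3 ≤ g) {i : ZMod g} {p : ℕ}
    (h : FreeAt G vc S i p) : ∃ x, P.ht x = p ∧ P.rt x = i ∧ (∀ s ∈ S, 0 < p → ¬ P.Desc x s) ∧
      ∀ s ∈ S, G.dist s x = P.ht s + cd (P.rt s) i + p := by
  rcases Nat.eq_zero_or_pos p with rfl | hp
  · refine ⟨vc i, P.ht_vc i, P.rt_vc i, fun _ _ h => absurd h (lt_irrefl 0), fun s _ => ?_⟩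
    rw [dist_comm, dist_vc (P := P) hG hg, cd_comm]
    omega
  · obtain rfl | ⟨t, ht, hf, hl⟩ := h
    · omega
    obtain ⟨-, c, hc, hcv, hleg⟩ := (P.isThreadAt_iff hg _ t).1 ht
    have hc1 := P.ht_par c hc
    rw [hcv, P.ht_vc] at hc1
    obtain ⟨z, hz, hzh⟩ := hleg.exists_at (m := p - 1) (by omega)
    have hrt : P.rt z = i := by rw [hz.rt_eq, ← P.rt_par c hc, hcv, P.rt_vc]
    have hcs : ∀ s ∈ S, ¬ P.Desc c s := fun s hs hd => hf s ((hleg.mem_iff s).2 hd) hs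
    refine ⟨z, by omega, hrt, fun s hs _ hd => hcs s hs (hz.trans hd), fun s hs => ?_⟩
    rw [dist_branch hG hg hc1.symm hz (hcs s hs), hrt]
    omega

lemma exists_edge_of_freeAt (P : Pres G g vc) (hG : G.Connected) (hg : 3 ≤ g) {i : ZMod g} {p : ℕ}
    (h : FreeAt G vc S i (p + 1)) : ∃ x, 0 < P.ht x ∧ P.rt x = i ∧
      ∀ s ∈ S, edgeDist G s (P.tedge x) = P.ht s + cd (P.rt s) i + p := by
  obtain ⟨x, hx, hrt, hd, hdist⟩ := P.exists_of_freeAt hG hg h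
  refine ⟨x, by omega, hrt, fun s hs => ?_⟩
  have h1 := edgeDist_tedge hG (by omega) (hd s hs (by omega))
  have h2 := hdist s hs
  omega

lemma not_isVertexMG_iff (P : Pres G g vc) (hG : G.Connected) (hg : 3 ≤ g)
    (hS : BranchResolving G S) (hA : ∀ i, ∃ s ∈ S, P.rt s ≠ i) :
    ¬ IsVertexMG G S ↔ VBad (SActive G g vc S) (FreeAt G vc S) := by
  have hact : ∀ s ∈ S, SActive G g vc S (P.rt s) := fun s hs => (P.sActive_iff S _).2 ⟨s, hs, rfl⟩
  constructor
  · intro h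
    unfold IsVertexMG at h
    push Not at h
    obtain ⟨x, y, hxy, h⟩ := h
    by_cases hrt : P.rt x = P.rt y
    · exfalso
      obtain ⟨s, hs, hsx⟩ := hA (P.rt x)
      have h1 := dist_of_rt_ne hG hg hsx
      have h2 := dist_of_rt_ne (P := P) hG hg (hrt ▸ hsx)
      rw [h s hs, hrt] at h1
      obtain ⟨b, c, hbc, hb, hc, hp, hx, hy⟩ := exists_fork hrt (by omega) hxy
      obtain ⟨s, hs, hd | hd⟩ := exists_desc_of_fork hg hS hbc hb hc hp
      · have h3 := dist_fork hG hbc hb hc hp hx hy hd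
        have h4 := h s hs
        omega
      · have h3 := dist_fork hG hbc.symm hc hb hp.symm hy hx hd
        have h4 := h s hs
        omega
    · obtain ⟨hx, hy⟩ := (isTreeDist_dist (P := P) hG hg x).exact_pair hg hrt hA
        (isTreeDist_dist hG hg y) h
      have hfx := freeAt_of_exact hG hg hS hx
      have hfy := freeAt_of_exact hG hg hS hy
      have hl : ∀ l, SActive G g vc S l → cd l (P.rt x) + P.ht x = cd l (P.rt y) + P.ht y := by
        intro l hl
        obtain ⟨s, hs, rfl⟩ := (P.sActive_iff S l).1 hl
        have h1 := hx s hs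
        have h2 := hy s hs
        have h3 := h s hs
        omega
      have mono : ∀ {i p}, FreeAt G vc S i p → ∀ q, FreeAt G vc S i (p - q) := by
        rintro i p (rfl | ⟨t, h1, h2, h3⟩) q
        · exact Or.inl (Nat.zero_sub q)
        · exact Or.inr ⟨t, h1, h2, by omega⟩
      rcases le_total (P.ht x) (P.ht y) with hle | hle
      · refine ⟨P.rt y, P.rt x, P.ht y - P.ht x, Ne.symm hrt, mono hfy _, fun l h => ?_⟩
        have := hl l h
        omega
      · refine ⟨P.rt x, P.rt y, P.ht x - P.ht y, hrt, mono hfx _, fun l h => ?_⟩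
        have := hl l h
        omega
  · rintro ⟨i, j, p, hij, hf, hl⟩ h
    obtain ⟨x, -, hrt, -, hx⟩ := P.exists_of_freeAt hG hg hf
    obtain ⟨y, -, hrt', -, hy⟩ := P.exists_of_freeAt (S := S) hG hg (i := j) (p := 0) (Or.inl rfl)
    obtain ⟨s, hs, hne⟩ := h x y (by rintro rfl; exact hij (hrt.symm.trans hrt'))
    rw [hx s hs, hy s hs, hl _ (hact s hs)] at hne
    omega

lemma not_isEdgeMG_iff (P : Pres G g vc) (hG : G.Connected) (hg : 3 ≤ g)
    (hvc : IsCycleLabelling G g vc)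
    (hS : BranchResolving G S) (hA : ∀ i, ∃ s ∈ S, P.rt s ≠ i) :
    ¬ IsEdgeMG G S ↔ EBad (SActive G g vc S) (FreeAt G vc S) := by
  have hact : ∀ s ∈ S, SActive G g vc S (P.rt s) := fun s hs => (P.sActive_iff S _).2 ⟨s, hs, rfl⟩
  have hmixed : ∀ x j, 0 < P.ht x →
      (∀ s ∈ S, edgeDist G s (P.tedge x) = edgeDist G s s(vc j, vc (j + 1))) →
      EBad (SActive G g vc S) (FreeAt G vc S) := by
    intro x j hx h
    have hex := (isTreeDist_tedge (P := P) hG hg hx).exact hA (ψ := fun l => ced l j)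
      (fun s _ => edgeDist_cycle (P := P) hG hg s j) (ced_le hg _ j) h
    refine Or.inr (Or.inl ⟨P.rt x, j, P.ht x - 1, ?_, fun l hl => ?_⟩)
    · rw [Nat.sub_add_cancel hx]
      exact freeAt_of_edge_exact hG hg hS hx hex
    · obtain ⟨s, hs, rfl⟩ := (P.sActive_iff S l).1 hl
      have h1 := hex s hs
      have h2 := h s hs
      rw [edgeDist_cycle (P := P) hG hg] at h2
      omega
  constructor
  · intro h
    unfold IsEdgeMG at h
    push Not at h
    obtain ⟨e, he, f, hf, hne, h⟩ := h
    rcases P.edge_cases he with ⟨x, hx, rfl⟩ | ⟨i, rfl⟩ <;>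
      rcases P.edge_cases hf with ⟨y, hy, rfl⟩ | ⟨j, rfl⟩
    · by_cases hrt : P.rt x = P.rt y
      · exfalso
        have hxy : x ≠ y := by
          rintro rfl
          exact hne rfl
        obtain ⟨s, hs, hsx⟩ := hA (P.rt x)
        have h1 := (isTreeDist_tedge (P := P) hG hg hx s).2 hsx
        have h2 := (isTreeDist_tedge (P := P) hG hg hy s).2 (hrt ▸ hsx)
        have h3 := h s hs
        simp only at h1 h2
        rw [hrt] at h1
        obtain ⟨b, c, hbc, hb, hc, hp, hbx, hcy⟩ := exists_fork hrt (by omega) hxy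
        obtain ⟨s, hs, hd | hd⟩ := exists_desc_of_fork hg hS hbc hb hc hp
        · obtain ⟨h4, -, h5⟩ := dist_fork hG hbc hb hc hp hbx hcy hd
          have h6 := edgeDist_within hG hd hbx
          have h7 := edgeDist_tedge hG hy (fun hs => h4 (hcy.trans hs))
          have h8 := h s hs
          omega
        · obtain ⟨h4, -, h5⟩ := dist_fork hG hbc.symm hc hb hp.symm hcy hbx hd
          have h6 := edgeDist_within hG hd hcy
          have h7 := edgeDist_tedge hG hx (fun hs => h4 (hbx.trans hs))
          have h8 := h s hs
          omega
      · obtain ⟨hex, hey⟩ := (isTreeDist_tedge (P := P) hG hg hx).exact_pair hg hrt hA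
          (isTreeDist_tedge hG hg hy) h
        refine Or.inl ⟨P.rt x, P.rt y, P.ht x - 1, P.ht y - 1, hrt, ?_, ?_, fun l hl => ?_⟩
        · rw [Nat.sub_add_cancel hx]
          exact freeAt_of_edge_exact hG hg hS hx hex
        · rw [Nat.sub_add_cancel hy]
          exact freeAt_of_edge_exact hG hg hS hy hey
        · obtain ⟨s, hs, rfl⟩ := (P.sActive_iff S l).1 hl
          have h1 := hex s hs
          have h2 := hey s hs
          have h3 := h s hs
          omega
    · exact hmixed x j hx h
    · exact hmixed y i hy fun s hs => (h s hs).symm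
    · refine Or.inr (Or.inr ⟨i, j, by rintro rfl; exact hne rfl, fun l hl => ?_⟩)
      obtain ⟨s, hs, rfl⟩ := (P.sActive_iff S l).1 hl
      have h1 := h s hs
      rw [edgeDist_cycle (P := P) hG hg, edgeDist_cycle (P := P) hG hg] at h1
      omega
  · have hcm : ∀ j, s(vc j, vc (j + 1)) ∈ G.edgeSet := fun j => hvc.2 j
    rintro (⟨i, j, p, q, hij, hi, hj, hl⟩ | ⟨i, j, p, hi, hl⟩ | ⟨i, j, hij, hl⟩) h
    · obtain ⟨x, hx, hrx, hdx⟩ := P.exists_edge_of_freeAt hG hg hi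
      obtain ⟨y, hy, hry, hdy⟩ := P.exists_edge_of_freeAt hG hg hj
      obtain ⟨s, hs, hne⟩ := h _ (tedge_mem hx) _ (tedge_mem hy) (fun he => by
        have := tedge_injective hx hy he
        subst this
        exact hij (hrx.symm.trans hry))
      have := hl _ (hact s hs)
      rw [hdx s hs, hdy s hs] at hne
      omega
    · obtain ⟨x, hx, hrx, hdx⟩ := P.exists_edge_of_freeAt hG hg hi
      obtain ⟨s, hs, hne⟩ := h _ (tedge_mem hx) _ (hcm j)
        (fun he => not_cycleEdges_of_ht hx ⟨j, he⟩)
      have := hl _ (hact s hs)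
      rw [hdx s hs, edgeDist_cycle (P := P) hG hg] at hne
      omega
    · obtain ⟨s, hs, hne⟩ := h _ (hcm i) _ (hcm j) (fun he => hij (cycle_edge_inj hg hvc he))
      have := hl _ (hact s hs)
      rw [edgeDist_cycle (P := P) hG hg, edgeDist_cycle (P := P) hG hg] at hne
      omega

end Pres

end Unicyclic

namespace Unicyclic

section NatCycle

/-- The distance between `a` and `b` on a cycle of length `n`, for representatives `a, b < n`. -/
def ncd (n a b : ℕ) : ℕ := min (a - b + (b - a)) (n - (a - b + (b - a)))

variable {n a b c k x y p : ℕ}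

lemma ncd_zero (n x : ℕ) : ncd n 0 x = min x (n - x) := by
  unfold ncd
  omega

lemma ncd_of_le (n : ℕ) (h : a ≤ b) : ncd n a b = min (b - a) (n - (b - a)) := by
  unfold ncd
  omega

lemma ncd_of_ge (n : ℕ) (h : b ≤ a) : ncd n a b = min (a - b) (n - (a - b)) := by
  unfold ncd
  omega

lemma ncd_triple_cases (hbc : b < c) (h1 : 2 * b ≤ n) (h2 : 2 * (c - b) ≤ n) (h3 : n ≤ 2 * c)
    (hx : x < n) :
    (x ≤ b ∧ ncd n 0 x = x ∧ ncd n b x + x = b ∧ 2 * ncd n c x ≤ n ∧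
        (ncd n c x + x = c ∨ ncd n c x + c = n + x)) ∨
      (b ≤ x ∧ x ≤ c ∧ ncd n b x + b = x ∧ ncd n c x + x = c ∧ 2 * ncd n 0 x ≤ n ∧
        (ncd n 0 x = x ∨ ncd n 0 x + x = n)) ∨
      (c ≤ x ∧ ncd n 0 x + x = n ∧ ncd n c x + c = x ∧ 2 * ncd n b x ≤ n ∧
        (ncd n b x + b = x ∨ ncd n b x + x = n + b)) := by
  rw [ncd_zero]
  rcases le_total b x with hbx | hbx
  · rcases le_total c x with hcx | hcx
    · rw [ncd_of_le n hbx, ncd_of_le n hcx]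
      omega
    · rw [ncd_of_le n hbx, ncd_of_ge n hcx]
      omega
  · rw [ncd_of_ge n hbx, ncd_of_ge n (hbx.trans hbc.le)]
    omega

lemma eq_of_ncd_triple (hb : 0 < b) (hbc : b < c) (hc : c < n) (h1 : 2 * b ≤ n)
    (h2 : 2 * (c - b) ≤ n) (h3 : n ≤ 2 * c) (hx : x < n) (hy : y < n)
    (e1 : ncd n 0 y = ncd n 0 x + p) (e2 : ncd n b y = ncd n b x + p)
    (e3 : ncd n c y = ncd n c x + p) : x = y := by
  have hX := ncd_triple_cases hbc h1 h2 h3 hx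
  have hY := ncd_triple_cases hbc h1 h2 h3 hy
  rw [e1, e2, e3] at hY
  generalize ncd n 0 x = X₀ at *
  generalize ncd n b x = X₁ at *
  generalize ncd n c x = X₂ at *
  rcases hX with ⟨u1, u2, u3, u4, u5 | u5⟩ | ⟨u0, u1, u2, u3, u4, u5 | u5⟩ |
    ⟨u1, u2, u3, u4, u5 | u5⟩ <;>
  rcases hY with ⟨v1, v2, v3, v4, v5 | v5⟩ | ⟨v0, v1, v2, v3, v4, v5 | v5⟩ |
    ⟨v1, v2, v3, v4, v5 | v5⟩ <;> omega

lemma ncd_pair_values (hkn : 2 * k ≤ n) (hx : x < n) :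
    (x ≤ k ∧ ncd n 0 x = x ∧ ncd n k x + x = k) ∨
      (k < x ∧ 2 * x ≤ n ∧ ncd n 0 x = x ∧ ncd n k x + k = x) ∨
      (n < 2 * x ∧ 2 * x < n + 2 * k ∧ ncd n 0 x + x = n ∧ ncd n k x + k = x) ∨
      (n + 2 * k ≤ 2 * x ∧ ncd n 0 x + x = n ∧ ncd n k x + x = n + k) := by
  rw [ncd_zero]
  rcases le_total k x with h | h
  · rw [ncd_of_le n h]
    omega
  · rw [ncd_of_ge n h]
    omega

lemma ncd_pair_cases (hk : 0 < k) (hkn : 2 * k ≤ n) (hx : x < n) (hy : y < n) (hxy : x ≠ y)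
    (e1 : ncd n 0 y = ncd n 0 x + p) (e2 : ncd n k y = ncd n k x + p) :
    (k ≤ x ∧ y = x + p ∧ 2 * y ≤ n) ∨
      (n + 2 * k ≤ 2 * y ∧ (y + p = x ∨ x = 0 ∧ y + p = n)) ∨
      (2 * (x + y) = n + 2 * k ∧ 2 * p + 2 * k = n ∧ 0 < x ∧ x < k) ∨
      (2 * (x + y) = n + 2 * k ∧ p = 0 ∧ 2 * k = n ∧ 0 < y ∧ y < k) := by
  have hX := ncd_pair_values hkn hx
  have hY := ncd_pair_values hkn hy
  rw [e1, e2] at hY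
  generalize ncd n 0 x = X at *
  generalize ncd n k x = Y at *
  clear e1 e2
  rcases hX with ⟨u1, u2, u3⟩ | ⟨u1, u2, u3, u4⟩ | ⟨u1, u2, u3, u4⟩ | ⟨u1, u2, u3⟩ <;>
  rcases hY with ⟨v1, v2, v3⟩ | ⟨v1, v2, v3, v4⟩ | ⟨v1, v2, v3, v4⟩ | ⟨v1, v2, v3⟩ <;> omega

lemma ncd_ne_of_between (hkn : 2 * k ≤ n) (hx : 0 < x) (hxk : x < k)
    (hs : 2 * (x + y) = n + 2 * k) (hp : 2 * p + 2 * k = n) (ha : 0 < a) (hak : a < k) :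
    ncd n a y ≠ ncd n a x + p := by
  rw [ncd_of_le n (show a ≤ y by omega)]
  rcases le_total a x with h | h <;> simp only [ncd_of_le, ncd_of_ge, *] <;> omega

end NatCycle

section

variable {g : ℕ}

lemma cd_eq_ncd (i j : ZMod g) : cd i j = ncd g i.val j.val := rfl

lemma two_mul_cd (i j : ZMod g) : 2 * cd i j = ncd (2 * g) (2 * i.val) (2 * j.val) := by
  unfold cd ncd
  omega

lemma two_mul_ced (hg : 3 ≤ g) (i j : ZMod g) :
    2 * ced i j + 1 = ncd (2 * g) (2 * i.val) (2 * j.val + 1) := by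
  have : NeZero g := ⟨by omega⟩
  have hi := ZMod.val_lt i
  have hj := ZMod.val_lt j
  have hs := val_succ hg j
  unfold ced cd ncd
  rw [hs]
  split_ifs
  · have : j.val = g - 1 := by omega
    rw [this]
    omega
  · rcases lt_or_ge j.val i.val with h | h
    · omega
    · omega

end

end Unicyclic

namespace Unicyclic

variable {g : ℕ} {A : ZMod g → Prop} {F : ZMod g → ℕ → Prop} {κ : ZMod g}

/-- The properties of the set `A` of active positions for a canonical labelling with last active
position `κ`. -/
structure Canon (A : ZMod g → Prop) (κ : ZMod g) : Prop where
  zero : A 0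
  last : A κ
  pos : 0 < κ.val
  le : ∀ l, A l → l.val ≤ κ.val
  geodesic : g < 2 * κ.val → ∃ b c, A b ∧ A c ∧ 0 < b.val ∧ b.val < c.val ∧ 2 * b.val ≤ g ∧
    2 * (c.val - b.val) ≤ g ∧ g ≤ 2 * c.val

/-- The active positions are only `0` and `κ`. -/
def OnlyTwo (A : ZMod g → Prop) (κ : ZMod g) : Prop := ∀ l, A l → l.val = 0 ∨ l.val = κ.val

lemma Canon.two_mul_le (h : Canon A κ) (h2 : OnlyTwo A κ) : 2 * κ.val ≤ g := by
  by_contra hcon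
  obtain ⟨b, c, hb, hc, h1, h3, h4, -, -⟩ := h.geodesic (by omega)
  have := h2 b hb
  have := h2 c hc
  omega

lemma not_vBad_of_triple (hg : 3 ≤ g) {b c : ZMod g} (h0 : A 0) (hb : A b) (hc : A c)
    (h1 : 0 < b.val) (h2 : b.val < c.val) (h3 : 2 * b.val ≤ g) (h4 : 2 * (c.val - b.val) ≤ g)
    (h5 : g ≤ 2 * c.val) : ¬ VBad A F := by
  have : NeZero g := ⟨by omega⟩
  rintro ⟨i, j, p, hij, -, h⟩
  have e0 := h 0 h0
  have e1 := h b hb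
  have e2 := h c hc
  rw [cd_eq_ncd, cd_eq_ncd, ZMod.val_zero] at e0
  exact hij (ZMod.val_injective g (eq_of_ncd_triple h1 h2 (ZMod.val_lt c) h3 h4 h5 (ZMod.val_lt i)
    (ZMod.val_lt j) e0 e1 e2))

lemma not_eBad_of_triple (hg : 3 ≤ g) {b c : ZMod g} (h0 : A 0) (hb : A b) (hc : A c)
    (h1 : 0 < b.val) (h2 : b.val < c.val) (h3 : 2 * b.val ≤ g) (h4 : 2 * (c.val - b.val) ≤ g)
    (h5 : g ≤ 2 * c.val) : ¬ EBad A F := by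
  have : NeZero g := ⟨by omega⟩
  have key : ∀ i j p, (∀ l, A l → cd l j = cd l i + p) → i = j := fun i j p h => by
    by_contra hij
    exact not_vBad_of_triple (F := fun _ _ => True) hg h0 hb hc h1 h2 h3 h4 h5
      ⟨i, j, p, hij, trivial, h⟩
  have hc' := ZMod.val_lt c
  have key2 : ∀ x y p, x < 2 * g → y < 2 * g → (∀ l, A l →
      ncd (2 * g) (2 * l.val) y = ncd (2 * g) (2 * l.val) x + p) → x = y := by
    intro x y p hx hy h
    have e0 := h 0 h0
    rw [ZMod.val_zero] at e0
    exact eq_of_ncd_triple (by omega) (by omega) (by omega) (by omega) (by omega) (by omega) hx hy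
      e0 (h b hb) (h c hc)
  rintro (⟨i, j, p, q, hij, -, -, h⟩ | ⟨i, j, p, -, h⟩ | ⟨i, j, hij, h⟩)
  · rcases le_total q p with hqp | hqp
    · exact hij (key i j (p - q) fun l hl => by have := h l hl; omega)
    · exact hij (key j i (q - p) fun l hl => by have := h l hl; omega).symm
  · have hi := ZMod.val_lt i
    have hj := ZMod.val_lt j
    have := key2 (2 * i.val) (2 * j.val + 1) (2 * p + 1) (by omega) (by omega) fun l hl => by
      rw [← two_mul_ced hg, ← two_mul_cd, ← h l hl]
      ring
    omega
  · have hi := ZMod.val_lt i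
    have hj := ZMod.val_lt j
    have := key2 (2 * i.val + 1) (2 * j.val + 1) 0 (by omega) (by omega) fun l hl => by
      rw [← two_mul_ced hg, ← two_mul_ced hg, h l hl]
    exact hij (ZMod.val_injective g (by omega))

lemma onlyTwo_of_forall (hle : ∀ l, A l → l.val ≤ κ.val)
    (h : ∀ l, A l → 0 < l.val → l.val < κ.val → False) : OnlyTwo A κ := by
  intro l hl
  have h1 := hle l hl
  have h2 := h l hl
  by_contra hcon
  exact h2 (by omega) (by omega)

lemma exists_val_eq (hg : 3 ≤ g) {m : ℕ} (hm : m < g) : ∃ j : ZMod g, j.val = m := by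
  have : NeZero g := ⟨by omega⟩
  exact ⟨m, ZMod.val_natCast_of_lt hm⟩

lemma vBad_iff (hg : 3 ≤ g) (hA : Canon A κ) (hF : ∀ i p q, q ≤ p → F i p → F i q)
    (hF0 : ∀ i, F i 0) : VBad A F ↔
    (κ.val ≤ g / 2 - 1 ∧ ∃ i : ZMod g, ((κ.val ≤ i.val ∧ i.val ≤ g / 2 - 1) ∨
      (g + 1) / 2 + κ.val + 1 ≤ i.val ∨ i = 0) ∧ F i 1) ∨
    (OnlyTwo A κ ∧ Even g ∧ κ.val ≤ g / 2 ∧ ∃ i : ZMod g, i.val ≤ κ.val ∧ F i (g / 2 - κ.val)) := by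
  have : NeZero g := ⟨by omega⟩
  have hκ := ZMod.val_lt κ
  have hpos := hA.pos
  constructor
  · intro hbad
    by_cases hkg : g < 2 * κ.val
    · obtain ⟨b, c, hb, hc, h1, h2, h3, h4, h5⟩ := hA.geodesic hkg
      exact absurd hbad (not_vBad_of_triple hg hA.zero hb hc h1 h2 h3 h4 h5)
    · obtain ⟨i, j, p, hij, hf, h⟩ := hbad
      have hi := ZMod.val_lt i
      have hj := ZMod.val_lt j
      have hne : i.val ≠ j.val := fun h => hij (ZMod.val_injective g h)
      have e0 := h 0 hA.zero
      have e1 := h κ hA.last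
      rw [cd_eq_ncd, cd_eq_ncd, ZMod.val_zero] at e0
      rcases ncd_pair_cases hpos (by omega) hi hj hne e0 e1 with
        h1 | ⟨h1, h2 | ⟨h2, h3⟩⟩ | ⟨h1, h2, h3, h4⟩ | ⟨h1, h2, h3, h4, h5⟩
      · exact Or.inl ⟨by omega, i, Or.inl (by omega), hF i p 1 (by omega) hf⟩
      · exact Or.inl ⟨by omega, i, Or.inr (Or.inl (by omega)), hF i p 1 (by omega) hf⟩
      · exact Or.inl ⟨by omega, i, Or.inr (Or.inr ((ZMod.val_eq_zero i).1 h2)),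
          hF i p 1 (by omega) hf⟩
      · refine Or.inr ⟨?_, ⟨p + κ.val, by omega⟩, by omega, i, by omega, hF i p _ (by omega) hf⟩
        exact onlyTwo_of_forall hA.le fun l hl hl0 hlκ =>
          ncd_ne_of_between (by omega) h3 h4 h1 h2 hl0 hlκ (h l hl)
      · refine Or.inr ⟨?_, ⟨κ.val, by omega⟩, by omega, 0, by rw [ZMod.val_zero]; omega,
          hF _ 0 _ (by omega) (hF0 0)⟩
        refine onlyTwo_of_forall hA.le fun l hl hl0 hlκ =>
          ncd_ne_of_between (n := g) (k := κ.val) (x := j.val) (y := i.val) (p := 0) (by omega)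
            h4 h5 (by omega) (by omega) hl0 hlκ ?_
        have := h l hl
        rw [cd_eq_ncd, cd_eq_ncd] at this
        omega
  · rintro (⟨hk, i, hi, hf⟩ | ⟨h2, he, hk, i, hi, hf⟩)
    · have hiv := ZMod.val_lt i
      rcases hi with hi | hi
      · have hs := val_succ hg i
        rw [if_neg (by omega)] at hs
        refine ⟨i, i + 1, 1, fun h => by rw [← h] at hs; omega, hf, fun l hl => ?_⟩
        have := hA.le l hl
        unfold cd
        omega
      · have hs := val_succ hg (i - 1)
        have hi' := ZMod.val_lt (i - 1)
        rw [sub_add_cancel] at hs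
        refine ⟨i, i - 1, 1, fun h => by rw [← h] at hs; split_ifs at hs <;> omega, hf,
          fun l hl => ?_⟩
        have hl' := hA.le l hl
        rw [cd_eq_ncd, cd_eq_ncd, ncd_of_le g (show l.val ≤ (i - 1).val by
          rcases hi with hi | rfl
          · split_ifs at hs <;> omega
          · rw [ZMod.val_zero] at hs
            split_ifs at hs; omega)]
        rcases hi with hi | rfl
        · split_ifs at hs
          · omega
          · rw [ncd_of_le g (by omega)]
            omega
        · rw [ZMod.val_zero] at hs ⊢
          split_ifs at hs
          rw [ncd_of_ge g (by omega)]
          omega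
    · rw [Nat.even_iff] at he
      rcases Nat.lt_or_ge κ.val (g / 2) with hlt | hge
      · obtain ⟨j, hj⟩ := exists_val_eq hg (show g / 2 + κ.val - i.val < g by omega)
        refine ⟨i, j, g / 2 - κ.val, fun h => by rw [h] at hi hj; omega, hf, fun l hl => ?_⟩
        rcases h2 l hl with hl | hl <;> unfold cd <;> omega
      · obtain ⟨x, hx⟩ := exists_val_eq hg (show 1 < g by omega)
        obtain ⟨y, hy⟩ := exists_val_eq hg (show g - 1 < g by omega)
        refine ⟨x, y, 0, fun h => by rw [h] at hx; omega, hF0 x, fun l hl => ?_⟩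
        rcases h2 l hl with hl | hl <;> unfold cd <;> omega

lemma eBad_iff (hg : 3 ≤ g) (hA : Canon A κ) (hF : ∀ i p q, q ≤ p → F i p → F i q) :
    EBad A F ↔ (OnlyTwo A κ ∧ Even g ∧ κ.val = g / 2) ∨
    (κ.val ≤ (g + 1) / 2 - 1 ∧ ∃ i : ZMod g, ((κ.val ≤ i.val ∧ i.val ≤ (g + 1) / 2 - 1) ∨
      g / 2 + κ.val + 1 ≤ i.val ∨ i = 0) ∧ F i 1) ∨
    (OnlyTwo A κ ∧ ∃ i : ZMod g, i.val ≤ κ.val ∧ F i (g / 2 - κ.val + 1) ∧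
      (Even g → F ((g / 2 + κ.val - i.val : ℕ) : ZMod g) 1)) := by
  have : NeZero g := ⟨by omega⟩
  have hκ := ZMod.val_lt κ
  have hpos := hA.pos
  have hcast : ∀ j : ZMod g, ∀ m : ℕ, j.val = m → (m : ZMod g) = j := by
    rintro j m rfl
    exact ZMod.natCast_zmod_val j
  constructor
  · intro hbad
    by_cases hkg : g < 2 * κ.val
    · obtain ⟨b, c, hb, hc, h1, h2, h3, h4, h5⟩ := hA.geodesic hkg
      exact absurd hbad (not_eBad_of_triple hg hA.zero hb hc h1 h2 h3 h4 h5)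
    · rcases hbad with ⟨i, j, p, q, hij, hi, hj, h⟩ | ⟨i, j, p, hf, h⟩ | ⟨i, j, hij, h⟩
      · wlog hqp : q ≤ p generalizing i j p q
        · exact this j i q p hij.symm hj hi (fun l hl => (h l hl).symm) (by omega)
        have hiv := ZMod.val_lt i
        have hjv := ZMod.val_lt j
        have hne : i.val ≠ j.val := fun h => hij (ZMod.val_injective g h)
        have h' : ∀ l, A l → ncd g l.val j.val = ncd g l.val i.val + (p - q) := fun l hl => by
          have := h l hl
          rw [cd_eq_ncd, cd_eq_ncd] at this
          omega
        have e0 := h' 0 hA.zero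
        rw [ZMod.val_zero] at e0
        have f1 := hF i _ 1 (by omega) hi
        rcases ncd_pair_cases hpos (by omega) hiv hjv hne e0 (h' κ hA.last) with
          h1 | ⟨h1, h2 | ⟨h2, h3⟩⟩ | ⟨h1, h2, h3, h4⟩ | ⟨h1, h2, h3, h4, h5⟩
        · exact Or.inr (Or.inl ⟨by omega, i, Or.inl (by omega), f1⟩)
        · exact Or.inr (Or.inl ⟨by omega, i, Or.inr (Or.inl (by omega)), f1⟩)
        · exact Or.inr (Or.inl ⟨by omega, i, Or.inr (Or.inr ((ZMod.val_eq_zero i).1 h2)), f1⟩)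
        · refine Or.inr (Or.inr ⟨?_, i, by omega, hF i _ _ (by omega) hi, fun _ => ?_⟩)
          · exact onlyTwo_of_forall hA.le fun l hl hl0 hlκ =>
              ncd_ne_of_between (by omega) h3 h4 h1 h2 hl0 hlκ (h' l hl)
          · rw [hcast j _ (by omega)]
            exact hF j _ 1 (by omega) hj
        · refine Or.inl ⟨?_, ⟨κ.val, by omega⟩, by omega⟩
          refine onlyTwo_of_forall hA.le fun l hl hl0 hlκ =>
            ncd_ne_of_between (n := g) (k := κ.val) (x := j.val) (y := i.val) (p := 0) (by omega)
              h4 h5 (by omega) (by omega) hl0 hlκ ?_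
          have := h' l hl
          omega
      · have hiv := ZMod.val_lt i
        have hjv := ZMod.val_lt j
        have h' : ∀ l, A l → ncd (2 * g) (2 * l.val) (2 * j.val + 1) =
            ncd (2 * g) (2 * l.val) (2 * i.val) + (2 * p + 1) := fun l hl => by
          rw [← two_mul_ced hg, ← two_mul_cd, ← h l hl]
          ring
        have e0 := h' 0 hA.zero
        rw [ZMod.val_zero, mul_zero] at e0
        have f1 := hF i _ 1 (by omega) hf
        rcases ncd_pair_cases (by omega) (by omega) (by omega) (by omega) (by omega) e0
          (h' κ hA.last) with
          h1 | ⟨h1, h2 | ⟨h2, h3⟩⟩ | ⟨h1, h2, h3, h4⟩ | ⟨h1, h2, h3, h4, h5⟩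
        · exact Or.inr (Or.inl ⟨by omega, i, Or.inl (by omega), f1⟩)
        · exact Or.inr (Or.inl ⟨by omega, i, Or.inr (Or.inl (by omega)), f1⟩)
        · exact Or.inr (Or.inl ⟨by omega, i,
            Or.inr (Or.inr ((ZMod.val_eq_zero i).1 (by omega))), f1⟩)
        · refine Or.inr (Or.inr ⟨?_, i, by omega, hF i _ _ (by omega) hf, fun he => ?_⟩)
          · exact onlyTwo_of_forall hA.le fun l hl hl0 hlκ =>
              ncd_ne_of_between (n := 2 * g) (k := 2 * κ.val) (by omega) h3 h4 h1 h2 (by omega)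
                (by omega) (h' l hl)
          · rw [Nat.even_iff] at he
            omega
        · omega
      · have hiv := ZMod.val_lt i
        have hjv := ZMod.val_lt j
        have hne : i.val ≠ j.val := fun h => hij (ZMod.val_injective g h)
        have h' : ∀ l, A l → ncd (2 * g) (2 * l.val) (2 * j.val + 1) =
            ncd (2 * g) (2 * l.val) (2 * i.val + 1) + 0 := fun l hl => by
          rw [← two_mul_ced hg, ← two_mul_ced hg, h l hl]
        have e0 := h' 0 hA.zero
        rw [ZMod.val_zero, mul_zero] at e0
        have two : ∀ x y, 2 * (x + y) = 2 * g + 2 * (2 * κ.val) → 2 * κ.val = g → 0 < x →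
            x < 2 * κ.val → (∀ l, A l → ncd (2 * g) (2 * l.val) y = ncd (2 * g) (2 * l.val) x) →
            OnlyTwo A κ := fun x y h1 h2 h3 h4 h =>
          onlyTwo_of_forall hA.le fun l hl hl0 hlκ =>
            ncd_ne_of_between (n := 2 * g) (k := 2 * κ.val) (p := 0) (by omega) h3 h4 h1 (by omega)
              (by omega) (by omega) (h l hl)
        rcases ncd_pair_cases (by omega) (by omega) (by omega) (by omega) (by omega) e0
          (h' κ hA.last) with
          h1 | ⟨h1, h2 | ⟨h2, h3⟩⟩ | ⟨h1, h2, h3, h4⟩ | ⟨h1, h2, h3, h4, h5⟩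
        · omega
        · omega
        · omega
        · exact Or.inl ⟨two _ _ h1 (by omega) h3 h4 h', ⟨κ.val, by omega⟩, by omega⟩
        · exact Or.inl ⟨two _ _ ((congrArg _ (add_comm _ _)).trans h1) (by omega) h4 h5
            fun l hl => (h' l hl).symm, ⟨κ.val, by omega⟩, by omega⟩
  · have hAbad : OnlyTwo A κ → Even g → κ.val = g / 2 → EBad A F := by
      intro h2 he hk
      rw [Nat.even_iff] at he
      obtain ⟨y, hy⟩ := exists_val_eq hg (show g - 1 < g by omega)
      have hs0 := val_succ hg (0 : ZMod g)
      have hsy := val_succ hg y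
      rw [ZMod.val_zero, if_neg (by omega)] at hs0
      rw [if_pos (by omega)] at hsy
      refine Or.inr (Or.inr ⟨0, y, fun h => by rw [← h, ZMod.val_zero] at hy; omega, ?_⟩)
      intro l hl
      have hz : (0 : ZMod g).val = 0 := ZMod.val_zero
      rcases h2 l hl with hl | hl <;> unfold ced cd <;> omega
    rintro (⟨h2, he, hk⟩ | ⟨hk, i, hi, hf⟩ | ⟨h2, i, hi, hf, hf'⟩)
    · exact hAbad h2 he hk
    · have hiv := ZMod.val_lt i
      rcases hi with hi | hi
      · have hs := val_succ hg i
        refine Or.inr (Or.inl ⟨i, i, 0, hf, fun l hl => ?_⟩)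
        have := hA.le l hl
        rw [if_neg (by omega)] at hs
        unfold ced
        rw [cd_eq_ncd, cd_eq_ncd, ncd_of_le g (by omega), ncd_of_le g (by omega)]
        omega
      · have hs := val_succ hg (i - 1)
        have hi' := ZMod.val_lt (i - 1)
        refine Or.inr (Or.inl ⟨i, i - 1, 0, hf, fun l hl => ?_⟩)
        have hl' := hA.le l hl
        unfold ced
        rw [sub_add_cancel] at hs ⊢
        rw [cd_eq_ncd, cd_eq_ncd]
        rcases hi with hi | rfl
        · split_ifs at hs
          · omega
          · rw [ncd_of_le g (show l.val ≤ (i - 1).val by omega),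
              ncd_of_le g (show l.val ≤ i.val by omega)]
            omega
        · rw [ZMod.val_zero] at hs ⊢
          split_ifs at hs
          rw [ncd_of_ge g (Nat.zero_le _), ncd_of_le g (show l.val ≤ (0 - 1 : ZMod g).val by omega)]
          omega
    · have hk := hA.two_mul_le h2
      rcases Nat.even_or_odd g with he | ho
      · by_cases hkg : κ.val = g / 2
        · exact hAbad h2 he hkg
        · have hf' := hf' he
          rw [Nat.even_iff] at he
          obtain ⟨j, hj⟩ := exists_val_eq hg (show g / 2 + κ.val - i.val < g by omega)
          rw [hcast j _ hj] at hf'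
          refine Or.inl ⟨i, j, g / 2 - κ.val, 0, fun h => by rw [h] at hi hj; omega, hf, hf',
            fun l hl => ?_⟩
          rcases h2 l hl with hl | hl <;> unfold cd <;> omega
      · rw [Nat.odd_iff] at ho
        obtain ⟨j, hj⟩ := exists_val_eq hg (show g / 2 + κ.val - i.val < g by omega)
        refine Or.inr (Or.inl ⟨i, j, g / 2 - κ.val, hf, fun l hl => ?_⟩)
        have e1 := two_mul_cd l i
        have e2 := two_mul_ced hg l j
        rcases h2 l hl with hl | hl
        · rw [ncd_of_le _ (by omega)] at e1 e2
          omega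
        · rw [ncd_of_ge _ (by omega)] at e1
          rw [ncd_of_le _ (by omega)] at e2
          omega

end Unicyclic

namespace Unicyclic

section Labelling

variable {V : Type*} {G : SimpleGraph V} {g : ℕ} {vc : ZMod g → V} {S : Set V}

lemma cycleEdges_shift (vc : ZMod g → V) (b : ZMod g) :
    cycleEdges g (fun x => vc (x + b)) = cycleEdges g vc := by
  ext e
  constructor
  · rintro ⟨i, rfl⟩
    exact ⟨i + b, by rw [add_right_comm]⟩
  · rintro ⟨i, rfl⟩
    refine ⟨i - b, ?_⟩
    beta_reduce
    rw [add_right_comm, sub_add_cancel]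

lemma isCycleLabelling_shift (h : IsCycleLabelling G g vc) (b : ZMod g) :
    IsCycleLabelling G g (fun x => vc (x + b)) := by
  refine ⟨fun x y hxy => add_right_cancel (h.1 hxy), fun i => ?_⟩
  beta_reduce
  rw [add_right_comm]
  exact h.2 (i + b)

lemma range_shift (vc : ZMod g → V) (b : ZMod g) :
    Set.range (fun x => vc (x + b)) = Set.range vc :=
  (Equiv.addRight b).surjective.range_comp vc

lemma sActive_shift (vc : ZMod g → V) (b i : ZMod g) :
    SActive G g (fun x => vc (x + b)) S i ↔ SActive G g vc S (i + b) := by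
  unfold SActive inTree offCycle
  rw [cycleEdges_shift]

lemma kOf_mem (hg : 3 ≤ g) (h : ∃ i, SActive G g vc S i) :
    kOf G g vc S < g ∧ SActive G g vc S (kOf G g vc S : ZMod g) := by
  have : NeZero g := ⟨by omega⟩
  obtain ⟨i, hi⟩ := h
  refine Nat.sSup_mem (s := {n : ℕ | n < g ∧ SActive G g vc S (n : ZMod g)})
    ⟨i.val, ZMod.val_lt i, ?_⟩ ⟨g, fun n hn => hn.1.le⟩
  rwa [ZMod.natCast_zmod_val]

lemma val_le_kOf (hg : 3 ≤ g) {i : ZMod g} (h : SActive G g vc S i) : i.val ≤ kOf G g vc S := by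
  have : NeZero g := ⟨by omega⟩
  refine le_csSup (s := {n : ℕ | n < g ∧ SActive G g vc S (n : ZMod g)})
    ⟨g, fun n hn => hn.1.le⟩ ⟨ZMod.val_lt i, ?_⟩
  rwa [ZMod.natCast_zmod_val]

lemma val_sub_eq (hg : 3 ≤ g) (l c : ZMod g) :
    (l - c).val = if c.val ≤ l.val then l.val - c.val else g + l.val - c.val := by
  have : NeZero g := ⟨by omega⟩
  have h1 := ZMod.val_add (l - c) c
  rw [sub_add_cancel] at h1
  have h2 := ZMod.val_lt (l - c)
  have h3 := ZMod.val_lt c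
  rcases Nat.lt_or_ge ((l - c).val + c.val) g with h | h
  · rw [Nat.mod_eq_of_lt h] at h1
    rw [if_pos (by omega)]
    omega
  · rw [Nat.mod_eq_sub_mod h, Nat.mod_eq_of_lt (by omega)] at h1
    rw [if_neg (by omega)]
    omega

lemma canon_of_canonical (hg : 3 ≤ g) (hcan : Canonical G g vc S)
    (h2 : ∃ i, i ≠ 0 ∧ SActive G g vc S i) :
    ∃ κ : ZMod g, κ.val = kOf G g vc S ∧ Canon (SActive G g vc S) κ := by
  classical
  have : NeZero g := ⟨by omega⟩
  obtain ⟨hvc, h0, hmin⟩ := hcan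
  obtain ⟨hk, hact⟩ := kOf_mem hg ⟨0, h0⟩
  obtain ⟨κ, hκ⟩ := exists_val_eq hg hk
  have hκ' : (kOf G g vc S : ZMod g) = κ := by rw [← hκ, ZMod.natCast_zmod_val]
  rw [hκ'] at hact
  refine ⟨κ, hκ, h0, hact, ?_, fun l hl => hκ ▸ val_le_kOf hg hl, fun hlt => ?_⟩
  · obtain ⟨i, hi, hai⟩ := h2
    have h1 := val_le_kOf hg hai
    have := mt (ZMod.val_eq_zero i).1 hi
    omega
  · obtain ⟨b, hb, hbmax⟩ := Finset.exists_max_image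
      (Finset.univ.filter fun l => SActive G g vc S l ∧ 2 * l.val ≤ g) ZMod.val
      ⟨0, by simpa using h0⟩
    obtain ⟨c, hc, hcmin⟩ := Finset.exists_min_image
      (Finset.univ.filter fun l => SActive G g vc S l ∧ g < 2 * l.val) ZMod.val
      ⟨κ, by simpa using ⟨hact, hlt⟩⟩
    simp only [Finset.mem_filter, Finset.mem_univ, true_and] at hb hbmax hc hcmin
    have hgap : kOf G g (fun x => vc (x + c)) S ≤ g - (c.val - b.val) := by
      obtain ⟨hk', hact'⟩ := kOf_mem (vc := fun x => vc (x + c)) hg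
        ⟨0, by rw [sActive_shift, zero_add]; exact hc.1⟩
      obtain ⟨l, hl⟩ := exists_val_eq hg hk'
      rw [← hl, ZMod.natCast_zmod_val, sActive_shift] at hact'
      have h1 := val_sub_eq hg (l + c) c
      rw [add_sub_cancel_right] at h1
      have h3 := ZMod.val_lt (l + c)
      have h4 := ZMod.val_lt c
      have h5 := hbmax (l + c)
      have h6 := hcmin (l + c)
      rw [← hl, h1]
      rcases Nat.lt_or_ge g (2 * (l + c).val) with h | h
      · have := h6 ⟨hact', h⟩
        rw [if_pos this]
        omega
      · have := h5 ⟨hact', h⟩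
        split_ifs <;> omega
    have hle := hmin _ (isCycleLabelling_shift hvc c) (range_shift vc c)
      (by rw [sActive_shift, zero_add]; exact hc.1)
    exact ⟨b, c, hb.1, hc.1, by omega, by omega, by omega, by omega, by omega⟩

lemma aS_eq_two_iff (hg : 3 ≤ g) {κ : ZMod g} (hA : Canon (SActive G g vc S) κ) :
    aS G g vc S = 2 ↔ OnlyTwo (SActive G g vc S) κ := by
  have : NeZero g := ⟨by omega⟩
  have hne : (0 : ZMod g) ≠ κ := by
    rintro rfl
    have := hA.pos
    rw [ZMod.val_zero] at this
    omega
  have hsub : {0, κ} ⊆ {i : ZMod g | SActive G g vc S i} := by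
    rintro x (rfl | rfl)
    · exact hA.zero
    · exact hA.last
  unfold aS
  constructor
  · intro h l hl
    have heq := Set.eq_of_subset_of_ncard_le hsub (by rw [h, Set.ncard_pair hne])
      (Set.toFinite _)
    have hl' : l ∈ ({0, κ} : Set (ZMod g)) := heq ▸ hl
    rcases hl' with rfl | rfl
    · exact Or.inl ZMod.val_zero
    · exact Or.inr rfl
  · intro h
    rw [← Set.ncard_pair hne]
    congr 1
    refine Set.Subset.antisymm (fun l hl => ?_) hsub
    rcases h l hl with h | h
    · exact Or.inl ((ZMod.val_eq_zero l).1 h)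
    · exact Or.inr (ZMod.val_injective g h)

lemma exists_canonical (hvc : IsCycleLabelling G g vc)
    (h : ∃ i, SActive G g vc S i) :
    ∃ vc' : ZMod g → V, Set.range vc' = Set.range vc ∧ Canonical G g vc' S := by
  classical
  obtain ⟨i, hi⟩ := h
  have hex : ∃ n, ∃ vc' : ZMod g → V, IsCycleLabelling G g vc' ∧
      Set.range vc' = Set.range vc ∧ SActive G g vc' S 0 ∧ kOf G g vc' S = n :=
    ⟨_, _, isCycleLabelling_shift hvc i, range_shift vc i,
      by rw [sActive_shift, zero_add]; exact hi, rfl⟩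
  obtain ⟨vc', h1, h2, h3, h4⟩ := Nat.find_spec hex
  refine ⟨vc', h2, h1, h3, fun vc'' h1' h2' h3' => ?_⟩
  rw [h4]
  exact Nat.find_min' hex ⟨vc'', h1', h2'.trans h2, h3', rfl⟩

end Labelling

section Config

variable {V : Type*} {G : SimpleGraph V} {g : ℕ} {vc : ZMod g → V} {S : Set V}
  [Fintype V] [DecidableEq V] [DecidableRel G.Adj] {κ : ZMod g} {i : ZMod g} {p q : ℕ}

lemma freeAt_anti (hqp : q ≤ p) (h : FreeAt G vc S i p) : FreeAt G vc S i q := by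
  rcases h with rfl | ⟨t, ht, hf, hp⟩
  · exact Or.inl (by omega)
  · exact Or.inr ⟨t, ht, hf, hqp.trans hp⟩

lemma freeAt_zero : FreeAt G vc S i 0 := Or.inl rfl

lemma freeAt_one_iff : FreeAt G vc S i 1 ↔ ∃ t : List V, IsThreadAt G (vc i) t ∧ SFree S t := by
  constructor
  · rintro (h | ⟨t, ht, hf, -⟩)
    · omega
    · exact ⟨t, ht, hf⟩
  · rintro ⟨t, ht, hf⟩
    exact Or.inr ⟨t, ht, hf, List.length_pos_iff.2 ht.1⟩

lemma freeAt_pos_iff (hp : 0 < p) : FreeAt G vc S i p ↔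
    ∃ t : List V, IsThreadAt G (vc i) t ∧ SFree S t ∧ p ≤ t.length :=
  ⟨fun h => h.resolve_left (by omega), Or.inr⟩

lemma config_vBad_iff (hg : 3 ≤ g) (hκ : κ.val = kOf G g vc S)
    (hA : Canon (SActive G g vc S) κ) :
    ConfigA G g vc S ∨ ConfigB G g vc S ∨ ConfigC G g vc S ↔
      VBad (SActive G g vc S) (FreeAt G vc S) := by
  have : NeZero g := ⟨by omega⟩
  rw [vBad_iff (F := FreeAt G vc S) hg hA (fun i p q h => freeAt_anti h) (fun i => freeAt_zero)]
  unfold ConfigA ConfigB ConfigC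
  rw [← hκ, aS_eq_two_iff hg hA]
  constructor
  · rintro (⟨h2, he, hk⟩ | ⟨hk, i, hi, ht⟩ | ⟨h2, he, hk, i, hi, t, ht⟩)
    · refine Or.inr ⟨h2, he, hk.le, 0, by rw [ZMod.val_zero]; omega, ?_⟩
      rw [hk, Nat.sub_self]
      exact freeAt_zero
    · refine Or.inl ⟨hk, i, ?_, freeAt_one_iff.2 ht⟩
      have hlt : i < g := by omega
      rw [ZMod.val_natCast_of_lt hlt]
      rcases hi with hi | hi | rfl
      · exact Or.inl hi
      · exact Or.inr (Or.inl hi.1)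
      · exact Or.inr (Or.inr Nat.cast_zero)
    · exact Or.inr ⟨h2, he, hk, i, by rwa [ZMod.val_natCast_of_lt (by omega)], Or.inr ⟨t, ht⟩⟩
  · rintro (⟨hk, i, hi, hf⟩ | ⟨h2, he, hk, i, hi, hf⟩)
    · refine Or.inr (Or.inl ⟨hk, i.val, ?_, ?_⟩)
      · have := ZMod.val_lt i
        rw [← ZMod.val_eq_zero i] at hi
        omega
      · rw [ZMod.natCast_zmod_val]
        exact freeAt_one_iff.1 hf
    · rcases hk.eq_or_lt with hk' | hk'
      · exact Or.inl ⟨h2, he, hk'⟩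
      · refine Or.inr (Or.inr ⟨h2, he, hk, i.val, hi, ?_⟩)
        rw [ZMod.natCast_zmod_val]
        exact (freeAt_pos_iff (by omega)).1 hf

lemma config_eBad_iff (hg : 3 ≤ g) (hκ : κ.val = kOf G g vc S)
    (hA : Canon (SActive G g vc S) κ) :
    ConfigA G g vc S ∨ ConfigD G g vc S ∨ ConfigE G g vc S ↔
      EBad (SActive G g vc S) (FreeAt G vc S) := by
  have : NeZero g := ⟨by omega⟩
  have hlt := ZMod.val_lt κ
  rw [eBad_iff (F := FreeAt G vc S) hg hA (fun i p q h => freeAt_anti h)]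
  unfold ConfigA ConfigD ConfigE
  rw [← hκ, aS_eq_two_iff hg hA]
  refine or_congr_right (or_congr ?_ ?_)
  · refine and_congr_right fun hk => ?_
    constructor
    · rintro ⟨i, hi, ht⟩
      refine ⟨i, ?_, freeAt_one_iff.2 ht⟩
      rw [ZMod.val_natCast_of_lt (by omega)]
      rcases hi with hi | hi | rfl
      · exact Or.inl hi
      · exact Or.inr (Or.inl hi.1)
      · exact Or.inr (Or.inr Nat.cast_zero)
    · rintro ⟨i, hi, hf⟩
      refine ⟨i.val, ?_, ?_⟩
      · have := ZMod.val_lt i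
        rw [← ZMod.val_eq_zero i] at hi
        omega
      · rw [ZMod.natCast_zmod_val]
        exact freeAt_one_iff.1 hf
  · refine and_congr_right fun _ => ?_
    simp only [freeAt_one_iff]
    simp only [freeAt_pos_iff (Nat.succ_pos _)]
    constructor
    · rintro ⟨i, hi, ht, ht'⟩
      have hv : (i : ZMod g).val = i := ZMod.val_natCast_of_lt (by omega)
      exact ⟨i, by rwa [hv], ht, by rwa [hv]⟩
    · rintro ⟨i, hi, ht, ht'⟩
      exact ⟨i.val, hi, by rwa [ZMod.natCast_zmod_val], ht'⟩

end Config

lemma configD_of_configB {V : Type*} [Fintype V] {G : SimpleGraph V} [DecidableRel G.Adj] {g : ℕ}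
    {vc : ZMod g → V} {S : Set V} (h : ConfigB G g vc S) : ConfigD G g vc S := by
  obtain ⟨hk, i, hi, ht⟩ := h
  exact ⟨by omega, i, by omega, ht⟩

end Unicyclic

namespace Unicyclic

section Range

variable {V : Type*} {G : SimpleGraph V} {g : ℕ} {vc vc' : ZMod g → V}

lemma cycleEdges_subset (P : Pres G g vc) (hvc' : IsCycleLabelling G g vc')
    (hr : Set.range vc' ⊆ Set.range vc) : cycleEdges g vc' ⊆ cycleEdges g vc := by
  have hht : ∀ i, P.ht (vc' i) = 0 := fun i => by
    obtain ⟨j, hj⟩ := hr ⟨i, rfl⟩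
    rw [← hj, P.ht_vc]
  rintro e ⟨i, rfl⟩
  rcases (P.adj_iff _ _).1 (hvc'.2 i) with ⟨h, -⟩ | ⟨h, -⟩ | ⟨j, ⟨h1, h2⟩ | ⟨h1, h2⟩⟩
  · rw [hht] at h
    omega
  · rw [hht] at h
    omega
  · exact ⟨j, by rw [h1, h2]⟩
  · exact ⟨j, by rw [h1, h2, Sym2.eq_swap]⟩

variable [Fintype V] [DecidableRel G.Adj]

lemma bG_le_bG (hg : 3 ≤ g) (P : Pres G g vc) (P' : Pres G g vc') (hvc : IsCycleLabelling G g vc)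
    (hvc' : IsCycleLabelling G g vc') (hr : Set.range vc' = Set.range vc) :
    bG G g vc ≤ bG G g vc' := by
  have : NeZero g := ⟨by omega⟩
  have hE : cycleEdges g vc' = cycleEdges g vc :=
    (cycleEdges_subset P hvc' hr.le).antisymm (cycleEdges_subset P' hvc hr.ge)
  have hσ : ∀ i, ∃ j, vc' j = vc i := fun i => hr.ge ⟨i, rfl⟩
  choose σ hσ using hσ
  refine Set.ncard_le_ncard_of_injOn σ ?_ ?_ (Set.toFinite _)
  · rintro i ⟨x, hx, hbr⟩
    refine ⟨x, ?_, ?_⟩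
    · unfold inTree offCycle at hx ⊢
      rwa [hE, hσ]
    · unfold Branching at hbr ⊢
      rwa [hr]
  · intro i _ j _ hij
    apply hvc.1
    rw [← hσ, ← hσ, hij]

end Range

section Smallest

variable {V : Type*} [Fintype V] {G : SimpleGraph V} [DecidableRel G.Adj] {S T : Set V}

lemma branchResolving_mono (hS : BranchResolving G S) (h : S ⊆ T) : BranchResolving G T :=
  fun v t₁ t₂ h₁ h₂ hne => (hS v t₁ t₂ h₁ h₂ hne).imp (fun ⟨s, hs, ht⟩ => ⟨s, h hs, ht⟩)
    fun ⟨s, hs, ht⟩ => ⟨s, h hs, ht⟩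

lemma sInf_card_eq {Q : Set V → Prop} {S : Finset V} (hS : SmallestBR G S)
    (hQ : ∀ T : Finset V, Q ↑T → BranchResolving G ↑T)
    (hQS : ∀ T : Finset V, SmallestBR G T → Q ↑T → Q ↑S)
    (hex : ∃ T : Finset V, T.card ≤ S.card + 1 ∧ Q ↑T) :
    (Q ↑S → sInf {n | ∃ T : Finset V, T.card = n ∧ Q ↑T} = S.card) ∧
      (¬ Q ↑S → sInf {n | ∃ T : Finset V, T.card = n ∧ Q ↑T} = S.card + 1) := by
  obtain ⟨T, hT, hTQ⟩ := hex
  obtain ⟨U, hU, hUQ⟩ := Nat.sInf_mem (s := {n | ∃ T : Finset V, T.card = n ∧ Q ↑T})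
    ⟨_, T, rfl, hTQ⟩
  have hle : ∀ W : Finset V, Q ↑W → sInf {n | ∃ T : Finset V, T.card = n ∧ Q ↑T} ≤ W.card :=
    fun W hW => Nat.sInf_le ⟨W, rfl, hW⟩
  rw [← hU] at hle ⊢
  have hSU := hS.2 U (hQ U hUQ)
  refine ⟨fun h => le_antisymm (hle S h) hSU, fun h => ?_⟩
  have := hle T hTQ
  have hne : S.card ≠ U.card := fun heq =>
    h (hQS U ⟨hQ U hUQ, fun W hW => heq ▸ hS.2 W hW⟩ hUQ)
  omega

end Smallest

section Resolving

variable {V : Type*} [Fintype V] [DecidableEq V] {G : SimpleGraph V} [DecidableRel G.Adj] {g : ℕ}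
  {vc : ZMod g → V} {S : Set V}

lemma exists_ne_sActive (hg : 3 ≤ g) (P : Pres G g vc) (hb : 2 ≤ bG G g vc)
    (hS : BranchResolving G S) (i : ZMod g) : ∃ j, j ≠ i ∧ SActive G g vc S j := by
  obtain ⟨j, hj, hji⟩ := Set.exists_ne_of_one_lt_ncard hb i
  exact ⟨j, hji, P.sActive_of_branchActive hg hS hj⟩

lemma exists_rt_ne (hg : 3 ≤ g) (P : Pres G g vc) (hb : 2 ≤ bG G g vc)
    (hS : BranchResolving G S) (i : ZMod g) : ∃ s ∈ S, P.rt s ≠ i := by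
  obtain ⟨j, hji, hj⟩ := exists_ne_sActive hg P hb hS i
  obtain ⟨s, hs, rfl⟩ := (P.sActive_iff S j).1 hj
  exact ⟨s, hs, hji⟩

lemma freeAt_transfer (hg : 3 ≤ g) (P : Pres G g vc) {S S' : Finset V} (hS' : SmallestBR G S')
    {i : ZMod g} {p : ℕ} (hp : p ≤ 1 ∨ ¬ SActive G g vc ↑S' i) (h : FreeAt G vc ↑S i p) :
    FreeAt G vc ↑S' i p := by
  rcases h with h | ⟨t, ht, hf, hl⟩
  · exact Or.inl h
  · rcases hp with hp | hp
    · exact freeAt_anti hp (freeAt_one_iff.2 (P.exists_free_thread hg hS' ht))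
    · refine Or.inr ⟨t, ht, fun u hu hus => hp ((P.sActive_iff _ i).2 ⟨u, hus, ?_⟩), hl⟩
      obtain ⟨-, c, hc, hci, hleg⟩ := (P.isThreadAt_iff hg _ t).1 ht
      rw [((hleg.mem_iff u).1 hu).rt_eq, ← P.rt_par c hc, hci, P.rt_vc]

lemma sActive_congr (hg : 3 ≤ g) (P : Pres G g vc) {S S' : Finset V} (hS : SmallestBR G S)
    (hS' : SmallestBR G S') : SActive G g vc (↑S : Set V) = SActive G g vc (↑S' : Set V) := by
  funext i
  exact propext ⟨fun h => P.sActive_of_branchActive hg hS'.1 (P.branchActive_of_sActive hg hS h),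
    fun h => P.sActive_of_branchActive hg hS.1 (P.branchActive_of_sActive hg hS' h)⟩

lemma vBad_transfer (hg : 3 ≤ g) (P : Pres G g vc) {κ : ZMod g} {S S' : Finset V}
    (hS : SmallestBR G S) (hS' : SmallestBR G S') (hA : Canon (SActive G g vc ↑S) κ)
    (h : VBad (SActive G g vc ↑S) (FreeAt G vc ↑S)) :
    VBad (SActive G g vc ↑S') (FreeAt G vc ↑S') := by
  have heq := sActive_congr hg P hS hS'
  rw [vBad_iff (F := FreeAt G vc ↑S) hg hA (fun i p q h => freeAt_anti h) fun i => freeAt_zero] at h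
  rw [← heq,
    vBad_iff (F := FreeAt G vc ↑S') hg hA (fun i p q h => freeAt_anti h) fun i => freeAt_zero]
  have : NeZero g := ⟨by omega⟩
  rcases h with ⟨hk, i, hi, hf⟩ | ⟨h2, he, hk, i, hi, hf⟩
  · exact Or.inl ⟨hk, i, hi, freeAt_transfer hg P hS' (Or.inl le_rfl) hf⟩
  · by_cases hcase : g / 2 - κ.val = 0 ∨ ¬ SActive G g vc ↑S' i
    · exact Or.inr ⟨h2, he, hk, i, hi, freeAt_transfer hg P hS' (hcase.imp_left (by omega)) hf⟩
    · rw [not_or, not_not, ← heq] at hcase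
      refine Or.inl ⟨by omega, i, ?_, freeAt_transfer hg P hS' (Or.inl le_rfl)
        (freeAt_anti (by omega) hf)⟩
      have := h2 i hcase.2
      rw [← ZMod.val_eq_zero i]
      omega

lemma eBad_transfer (hg : 3 ≤ g) (P : Pres G g vc) {κ : ZMod g} {S S' : Finset V}
    (hS : SmallestBR G S) (hS' : SmallestBR G S') (hA : Canon (SActive G g vc ↑S) κ)
    (h : EBad (SActive G g vc ↑S) (FreeAt G vc ↑S)) :
    EBad (SActive G g vc ↑S') (FreeAt G vc ↑S') := by
  have heq := sActive_congr hg P hS hS'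
  rw [eBad_iff (F := FreeAt G vc ↑S) hg hA fun i p q h => freeAt_anti h] at h
  rw [← heq, eBad_iff (F := FreeAt G vc ↑S') hg hA fun i p q h => freeAt_anti h]
  have : NeZero g := ⟨by omega⟩
  rcases h with h | ⟨hk, i, hi, hf⟩ | ⟨h2, i, hi, hf, hf'⟩
  · exact Or.inl h
  · exact Or.inr (Or.inl ⟨hk, i, hi, freeAt_transfer hg P hS' (Or.inl le_rfl) hf⟩)
  · by_cases hact : SActive G g vc ↑S' i
    · rw [← heq] at hact
      have h2κ := hA.two_mul_le h2
      by_cases hk : κ.val ≤ (g + 1) / 2 - 1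
      · refine Or.inr (Or.inl ⟨hk, i, ?_, freeAt_transfer hg P hS' (Or.inl le_rfl)
          (freeAt_anti (by omega) hf)⟩)
        have := h2 i hact
        rw [← ZMod.val_eq_zero i]
        omega
      · exact Or.inl ⟨h2, ⟨κ.val, by omega⟩, by omega⟩
    · exact Or.inr (Or.inr ⟨h2, i, hi, freeAt_transfer hg P hS' (Or.inr hact) hf,
        fun he => freeAt_transfer hg P hS' (Or.inl le_rfl) (hf' he)⟩)

lemma exists_triple (hg : 3 ≤ g) {A : ZMod g → Prop} {κ : ZMod g} (hA : Canon A κ) :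
    ∃ a, ∀ B : ZMod g → Prop, (∀ l, A l → B l) → B a → ∀ F, ¬ VBad B F ∧ ¬ EBad B F := by
  have hpos := hA.pos
  by_cases hlt : g < 2 * κ.val
  · obtain ⟨b, c, hb, hc, h1, h2, h3, h4, h5⟩ := hA.geodesic hlt
    exact ⟨0, fun B hAB _ F =>
      ⟨not_vBad_of_triple hg (hAB _ hA.zero) (hAB _ hb) (hAB _ hc) h1 h2 h3 h4 h5,
        not_eBad_of_triple hg (hAB _ hA.zero) (hAB _ hb) (hAB _ hc) h1 h2 h3 h4 h5⟩⟩
  · obtain ⟨c, hc⟩ := exists_val_eq hg (show κ.val + (g - κ.val) / 2 < g by omega)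
    refine ⟨c, fun B hAB hBc F => ⟨not_vBad_of_triple hg (hAB _ hA.zero) (hAB _ hA.last) hBc
      ?_ ?_ ?_ ?_ ?_, not_eBad_of_triple hg (hAB _ hA.zero) (hAB _ hA.last) hBc ?_ ?_ ?_ ?_ ?_⟩⟩ <;> omega

lemma exists_isMG (hG : G.Connected) (hg : 3 ≤ g) (hvc : IsCycleLabelling G g vc)
    (P : Pres G g vc) (hb : 2 ≤ bG G g vc) {κ : ZMod g} {S : Finset V} (hS : BranchResolving G ↑S)
    (hA : Canon (SActive G g vc ↑S) κ) :
    ∃ T : Finset V, T.card ≤ S.card + 1 ∧ IsVertexMG G ↑T ∧ IsEdgeMG G ↑T := by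
  obtain ⟨a, ha⟩ := exists_triple hg hA
  have hsub : (↑S : Set V) ⊆ ↑(insert (vc a) S) := Finset.coe_subset.2 (Finset.subset_insert _ _)
  have hT := branchResolving_mono hS hsub
  have := ha (SActive G g vc ↑(insert (vc a) S)) (fun l ⟨s, hs, hl⟩ => ⟨s, hsub hs, hl⟩)
    ⟨vc a, Finset.mem_coe.2 (Finset.mem_insert_self _ _), Reachable.refl _⟩
    (FreeAt G vc ↑(insert (vc a) S))
  rw [← P.not_isVertexMG_iff hG hg hT (exists_rt_ne hg P hb hT),
    ← P.not_isEdgeMG_iff hG hg hvc hT (exists_rt_ne hg P hb hT), not_not, not_not] at this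
  exact ⟨_, Finset.card_insert_le _ _, this⟩

end Resolving

section Dimension

variable {V : Type*} [Fintype V] [DecidableEq V] {G : SimpleGraph V} [DecidableRel G.Adj] {g : ℕ}
  {vc : ZMod g → V} {S : Finset V}

lemma exists_canon (hG : IsUnicyclic G) (hg : 3 ≤ g) (hvc : IsCycleLabelling G g vc)
    (hb : 2 ≤ bG G g vc) {S : Set V} (hS : BranchResolving G S) {vc' : ZMod g → V}
    (hr : Set.range vc' = Set.range vc) (hcan : Canonical G g vc' S) :
    ∃ (_ : Pres G g vc') (κ : ZMod g), 2 ≤ bG G g vc' ∧ κ.val = kOf G g vc' S ∧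
      Canon (SActive G g vc' S) κ := by
  obtain ⟨P⟩ := exists_pres hG hg hvc
  obtain ⟨P'⟩ := exists_pres hG hg hcan.1
  have hb' := hb.trans (bG_le_bG hg P P' hvc hcan.1 hr)
  obtain ⟨κ, h⟩ := canon_of_canonical hg hcan (exists_ne_sActive hg P' hb' hS 0)
  exact ⟨P', κ, hb', h⟩

lemma config_iff (hG : IsUnicyclic G) (hg : 3 ≤ g) (hvc : IsCycleLabelling G g vc)
    (hb : 2 ≤ bG G g vc) {S : Set V} (hS : BranchResolving G S) {vc' : ZMod g → V}
    (hr : Set.range vc' = Set.range vc) (hcan : Canonical G g vc' S) :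
    (ConfigA G g vc' S ∨ ConfigB G g vc' S ∨ ConfigC G g vc' S ↔ ¬ IsVertexMG G S) ∧
      (ConfigA G g vc' S ∨ ConfigD G g vc' S ∨ ConfigE G g vc' S ↔ ¬ IsEdgeMG G S) := by
  obtain ⟨P, κ, hb', hκ, hA⟩ := exists_canon hG hg hvc hb hS hr hcan
  have hrt := exists_rt_ne hg P hb' hS
  rw [P.not_isVertexMG_iff hG.1 hg hS hrt, P.not_isEdgeMG_iff hG.1 hg hcan.1 hS hrt]
  exact ⟨config_vBad_iff hg hκ hA, config_eBad_iff hg hκ hA⟩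

lemma exists_canonical_of_bG (hG : IsUnicyclic G) (hg : 3 ≤ g) (hvc : IsCycleLabelling G g vc)
    (hb : 2 ≤ bG G g vc) {S : Set V} (hS : BranchResolving G S) :
    ∃ vc' : ZMod g → V, Set.range vc' = Set.range vc ∧ Canonical G g vc' S := by
  obtain ⟨P⟩ := exists_pres hG hg hvc
  obtain ⟨i, -, hi⟩ := exists_ne_sActive hg P hb hS 0
  exact exists_canonical hvc ⟨i, hi⟩

lemma containsABC_iff (hG : IsUnicyclic G) (hg : 3 ≤ g) (hvc : IsCycleLabelling G g vc)
    (hb : 2 ≤ bG G g vc) {S : Set V} (hS : BranchResolving G S) :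
    ContainsABC G g vc S ↔ ¬ IsVertexMG G S := by
  constructor
  · rintro (⟨vc', -, hr, hcan, h⟩ | ⟨vc', -, hr, hcan, h⟩ | ⟨vc', -, hr, hcan, h⟩) <;>
      exact (config_iff hG hg hvc hb hS hr hcan).1.1 (by tauto)
  · intro h
    obtain ⟨vc', hr, hcan⟩ := exists_canonical_of_bG hG hg hvc hb hS
    exact ((config_iff hG hg hvc hb hS hr hcan).1.2 h).imp (fun h => ⟨vc', hcan.1, hr, hcan, h⟩)
      (Or.imp (fun h => ⟨vc', hcan.1, hr, hcan, h⟩) fun h => ⟨vc', hcan.1, hr, hcan, h⟩)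

lemma containsADE_iff (hG : IsUnicyclic G) (hg : 3 ≤ g) (hvc : IsCycleLabelling G g vc)
    (hb : 2 ≤ bG G g vc) {S : Set V} (hS : BranchResolving G S) :
    ContainsADE G g vc S ↔ ¬ IsEdgeMG G S := by
  constructor
  · rintro (⟨vc', -, hr, hcan, h⟩ | ⟨vc', -, hr, hcan, h⟩ | ⟨vc', -, hr, hcan, h⟩) <;>
      exact (config_iff hG hg hvc hb hS hr hcan).2.1 (by tauto)
  · intro h
    obtain ⟨vc', hr, hcan⟩ := exists_canonical_of_bG hG hg hvc hb hS
    exact ((config_iff hG hg hvc hb hS hr hcan).2.2 h).imp (fun h => ⟨vc', hcan.1, hr, hcan, h⟩)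
      (Or.imp (fun h => ⟨vc', hcan.1, hr, hcan, h⟩) fun h => ⟨vc', hcan.1, hr, hcan, h⟩)

lemma dims_eq (hG : IsUnicyclic G) (hg : 3 ≤ g) (hvc : IsCycleLabelling G g vc)
    (hb : 2 ≤ bG G g vc) (hS : SmallestBR G S) :
    ((IsVertexMG G ↑S → metricDim G = S.card) ∧ (¬ IsVertexMG G ↑S → metricDim G = S.card + 1)) ∧
      ((IsEdgeMG G ↑S → edgeMetricDim G = S.card) ∧
        (¬ IsEdgeMG G ↑S → edgeMetricDim G = S.card + 1)) := by
  obtain ⟨vc', hr, hcan⟩ := exists_canonical_of_bG hG hg hvc hb hS.1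
  obtain ⟨P, κ, hb', -, hA⟩ := exists_canon hG hg hvc hb hS.1 hr hcan
  obtain ⟨T, hT, hTv, hTe⟩ := exists_isMG hG.1 hg hcan.1 P hb' hS.1 hA
  constructor
  · refine sInf_card_eq hS (fun T => P.branchResolving_of_isVertexMG hG.1 hg) (fun U hU => ?_)
      ⟨T, hT, hTv⟩
    contrapose
    rw [P.not_isVertexMG_iff hG.1 hg hS.1 (exists_rt_ne hg P hb' hS.1),
      P.not_isVertexMG_iff hG.1 hg hU.1 (exists_rt_ne hg P hb' hU.1)]
    exact vBad_transfer hg P hS hU hA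
  · refine sInf_card_eq hS (fun T => P.branchResolving_of_isEdgeMG hG.1 hg) (fun U hU => ?_)
      ⟨T, hT, hTe⟩
    contrapose
    rw [P.not_isEdgeMG_iff hG.1 hg hcan.1 hS.1 (exists_rt_ne hg P hb' hS.1),
      P.not_isEdgeMG_iff hG.1 hg hcan.1 hU.1 (exists_rt_ne hg P hb' hU.1)]
    exact eBad_transfer hg P hS hU hA

end Dimension

end Unicyclic

theorem statement_11 {V : Type*} [Fintype V] [DecidableEq V] (G : SimpleGraph V)
    [DecidableRel G.Adj] (hG : IsUnicyclic G) (g : ℕ) (hg : 3 ≤ g)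
    (vc : ZMod g → V) (hvc : IsCycleLabelling G g vc)
    (hb : 2 ≤ bG G g vc) (S : Finset V) (hS : SmallestBR G S) :
    (ContainsC G g vc ↑S ∧ ¬ ContainsA G g vc ↑S ∧ ¬ ContainsD G g vc ↑S ∧
        ¬ ContainsE G g vc ↑S →
      (metricDim G : ℤ) - edgeMetricDim G = 1) ∧
    ((ContainsD G g vc ↑S ∨ ContainsE G g vc ↑S) ∧ ¬ ContainsA G g vc ↑S ∧
        ¬ ContainsB G g vc ↑S ∧ ¬ ContainsC G g vc ↑S →
      (metricDim G : ℤ) - edgeMetricDim G = -1) ∧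
    (¬ (ContainsC G g vc ↑S ∧ ¬ ContainsA G g vc ↑S ∧ ¬ ContainsD G g vc ↑S ∧
        ¬ ContainsE G g vc ↑S) →
     ¬ ((ContainsD G g vc ↑S ∨ ContainsE G g vc ↑S) ∧ ¬ ContainsA G g vc ↑S ∧
        ¬ ContainsB G g vc ↑S ∧ ¬ ContainsC G g vc ↑S) →
      (metricDim G : ℤ) - edgeMetricDim G = 0) := by
  have hV := Unicyclic.containsABC_iff hG hg hvc hb hS.1
  have hE := Unicyclic.containsADE_iff hG hg hvc hb hS.1
  unfold ContainsABC at hV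
  unfold ContainsADE at hE
  have hBD : ContainsB G g vc ↑S → ContainsD G g vc ↑S := fun ⟨vc', h1, h2, h3, h4⟩ =>
    ⟨vc', h1, h2, h3, Unicyclic.configD_of_configB h4⟩
  obtain ⟨⟨v1, v2⟩, e1, e2⟩ := Unicyclic.dims_eq hG hg hvc hb hS
  generalize IsVertexMG G ↑S = pv at *
  generalize IsEdgeMG G ↑S = pe at *
  generalize ContainsA G g vc ↑S = a at *
  generalize ContainsB G g vc ↑S = b at *
  generalize ContainsC G g vc ↑S = c at *
  generalize ContainsD G g vc ↑S = d at *
  generalize ContainsE G g vc ↑S = e at *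
  have hC : c ∧ ¬a ∧ ¬d ∧ ¬e ↔ ¬pv ∧ pe := by
    clear v1 v2 e1 e2
    grind
  have hDE : (d ∨ e) ∧ ¬a ∧ ¬b ∧ ¬c ↔ pv ∧ ¬pe := by
    clear v1 v2 e1 e2
    grind
  rw [hC, hDE]
  by_cases hv : pv <;> by_cases he : pe <;> simp [hv, he, v1, v2, e1, e2]
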